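/- arXiv:1707.04843 — 4 statements merged into one kernel-verified Lean document; each statement's English description precedes it below -/
import Mathlib

section
/- Let 𝕂 be ℝ or ℂ, m, n ≥ 1, ε, η ≥ 1, d := ε+η+1, and let L(λ) be the (ε,n,η,m)-block Kronecker pencil with (1,1)-block λM_1+M_0. Let ΔL(λ) be any pencil of the same size as L(λ) with ‖ΔL(λ)‖_F < ((√2−1)/d)² · 1/(1 + ‖λM_1+M_0‖_F), and let ΔL_{11}(λ) denote its (1,1)-block of size (η+1)m×(ε+1)n. Then there exist constant matrices C ∈ 𝕂^{εn×(η+1)m} and D ∈ 𝕂^{(ε+1)n×ηm} with sqrt(‖C‖_F²+‖D‖_F²) ≤ d·‖ΔL(λ)‖_F/(√2−1), and pencils ΔL̃_{12}(λ) of size (η+1)m×ηm and ΔL̃_{21}(λ) of size εn×(ε+1)n, such that [[I_{(η+1)m}, 0],[C, I_{εn}]]·(L(λ)+ΔL(λ))·[[I_{(ε+1)n}, D],[0, I_{ηm}]] = [[λM_1+M_0+ΔL_{11}(λ), L_η(λ)ᵀ⊗I_m + ΔL̃_{12}(λ)],[L_ε(λ)⊗I_n + ΔL̃_{21}(λ),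 0]] (in particular the (2,2)-block of the transformed pencil is zero), and max{‖ΔL̃_{21}(λ)‖_F, ‖ΔL̃_{12}(λ)‖_F} ≤ ‖ΔL(λ)‖_F·(1 + (d/(√2−1))·(‖λM_1+M_0‖_F + ‖ΔL(λ)‖_F)). -/
open Polynomial Matrix
open scoped Kronecker

/-- Euclidean norm of a (finitely indexed) vector over `𝕂 = ℝ` or `ℂ`. -/
noncomputable def evnorm {𝕂 : Type*} [RCLike 𝕂] {ι : Type*} [Fintype ι] (x : ι → 𝕂) : ℝ :=
  Real.sqrt (∑ i, ‖x i‖ ^ 2)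

/-- Frobenius norm of a constant matrix over `𝕂 = ℝ` or `ℂ`. -/
noncomputable def frobNorm {𝕂 : Type*} [RCLike 𝕂] {ι κ : Type*} [Fintype ι] [Fintype κ]
    (A : Matrix ι κ 𝕂) : ℝ :=
  Real.sqrt (∑ i, ∑ j, ‖A i j‖ ^ 2)

/-- Spectral norm (largest singular value; `ℓ²→ℓ²` operator norm) of a constant matrix:
the least `c ≥ 0` with `‖Ax‖₂ ≤ c‖x‖₂` for all `x`. -/
noncomputable def specNorm {𝕂 : Type*} [RCLike 𝕂] {ι κ : Type*} [Fintype ι] [Fintype κ]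
    (A : Matrix ι κ 𝕂) : ℝ :=
  sInf {c : ℝ | 0 ≤ c ∧ ∀ x : κ → 𝕂, evnorm (A.mulVec x) ≤ c * evnorm x}

/-- Frobenius norm of a matrix polynomial `P(λ) = Σ_i P_i λ^i`:
`‖P‖_F = sqrt(Σ_i ‖P_i‖_F²)` (sum over all nonzero coefficients; independent of the grade
used to represent `P`). -/
noncomputable def polyFrob {𝕂 : Type*} [RCLike 𝕂] {ι κ : Type*} [Fintype ι] [Fintype κ]
    (P : Matrix ι κ (Polynomial 𝕂)) : ℝ :=
  Real.sqrt (∑ i, ∑ j, ∑ k ∈ (P i j).support, ‖(P i j).coeff k‖ ^ 2)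

/-- The `k×(k+1)` pencil `L_k(λ)` with `-1` on the main diagonal and `λ` on the superdiagonal. -/
noncomputable def Lk (R : Type*) [CommRing R] (k : ℕ) :
    Matrix (Fin k) (Fin (k + 1)) (Polynomial R) :=
  Matrix.of fun i j =>
    if (j : ℕ) = (i : ℕ) then -1 else if (j : ℕ) = (i : ℕ) + 1 then Polynomial.X else 0

/-- The `(k+1)×1` vector polynomial `Λ_k(λ) = (λ^k, λ^{k-1}, …, λ, 1)ᵀ`. -/
noncomputable def Lam (R : Type*) [CommRing R] (k : ℕ) :
    Matrix (Fin (k + 1)) (Fin 1) (Polynomial R) :=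
  Matrix.of fun i _ => Polynomial.X ^ (k - (i : ℕ))

/-- The `(ε,n,η,m)`-block Kronecker pencil
`L(λ) = [[λM₁+M₀, L_η(λ)ᵀ⊗I_m],[L_ε(λ)⊗I_n, 0]]`, whose `(1,1)` block is the pencil `M`. -/
noncomputable def blockKron (R : Type*) [CommRing R] (ε n η m : ℕ)
    (M : Matrix (Fin (η + 1) × Fin m) (Fin (ε + 1) × Fin n) (Polynomial R)) :
    Matrix ((Fin (η + 1) × Fin m) ⊕ (Fin ε × Fin n))
      ((Fin (ε + 1) × Fin n) ⊕ (Fin η × Fin m)) (Polynomial R) :=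
  Matrix.fromBlocks M
    ((Lk R η).transpose ⊗ₖ (1 : Matrix (Fin m) (Fin m) (Polynomial R)))
    ((Lk R ε) ⊗ₖ (1 : Matrix (Fin n) (Fin n) (Polynomial R))) 0

/-- `Q(λ) := (Λ_η(λ)ᵀ⊗I_m)·(λM₁+M₀)·(Λ_ε(λ)⊗I_n)`, the `m×n` matrix polynomial associated
with the `(1,1)` block `M` of a block Kronecker pencil. -/
noncomputable def QpolyOf (R : Type*) [CommRing R] (ε n η m : ℕ)
    (M : Matrix (Fin (η + 1) × Fin m) (Fin (ε + 1) × Fin n) (Polynomial R)) :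
    Matrix (Fin 1 × Fin m) (Fin 1 × Fin n) (Polynomial R) :=
  ((Lam R η).transpose ⊗ₖ (1 : Matrix (Fin m) (Fin m) (Polynomial R))) * M *
    ((Lam R ε) ⊗ₖ (1 : Matrix (Fin n) (Fin n) (Polynomial R)))

/-! helper material -/

/-- recursion for the right inverse -/
def drec {E : Type*} [AddCommGroup E] (b0 b1 : ℕ → ℕ → E) : ℕ → ℕ → E
  | 0, _ => 0
  | i + 1, j => b1 i j + (drec b0 b1 i (j + 1) + b0 i (j + 1))

theorem drec_sub {E : Type*} [AddCommGroup E] (b0 b1 c0 c1 : ℕ → ℕ → E) (i j : ℕ) :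
    drec (fun i j => b0 i j - c0 i j) (fun i j => b1 i j - c1 i j) i j
      = drec b0 b1 i j - drec c0 c1 i j := by
  induction i generalizing j with
  | zero => simp [drec]
  | succ i ih => simp only [drec, ih]; abel

theorem drec_zero {E : Type*} [AddCommGroup E] (b0 b1 : ℕ → ℕ → E) (η : ℕ)
    (h0 : ∀ i j, η ≤ j → b0 i j = 0) (h1 : ∀ i j, η ≤ j → b1 i j = 0) (i j : ℕ) (hj : η ≤ j) :
    drec b0 b1 i j = 0 := by
  induction i generalizing j with
  | zero => simp [drec]
  | succ i ih =>
    simp only [drec]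
    rw [ih (j + 1) (by omega), h0 i (j+1) (by omega), h1 i j hj]; simp

theorem sum_add_sq_le {E : Type*} [SeminormedAddCommGroup E] (s : Finset ℕ) (x y : ℕ → E)
    (k A B : ℝ) (hk : 0 ≤ k) (hA : 0 ≤ A)
    (hx : ∑ j ∈ s, ‖x j‖ ^ 2 ≤ k * A) (hy : ∑ j ∈ s, ‖y j‖ ^ 2 ≤ B) :
    ∑ j ∈ s, ‖x j + y j‖ ^ 2 ≤ (k + 1) * (A + B) := by
  have hB : 0 ≤ B := le_trans (Finset.sum_nonneg fun _ _ => by positivity) hy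
  have htri : ∑ j ∈ s, ‖x j + y j‖ ^ 2 ≤ ∑ j ∈ s, (‖x j‖ + ‖y j‖) ^ 2 := by
    gcongr with j hj
    exact norm_add_le _ _
  refine htri.trans ?_
  rcases hk.eq_or_lt with h | h
  · subst h
    have hx0 : ∑ j ∈ s, ‖x j‖ ^ 2 = 0 :=
      le_antisymm (by simpa using hx) (Finset.sum_nonneg fun _ _ => by positivity)
    rw [Finset.sum_eq_zero_iff_of_nonneg (fun _ _ => by positivity)] at hx0
    have : ∑ j ∈ s, (‖x j‖ + ‖y j‖) ^ 2 = ∑ j ∈ s, ‖y j‖ ^ 2 := by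
      refine Finset.sum_congr rfl fun j hj => ?_
      have := hx0 j hj
      rw [pow_eq_zero_iff (by norm_num)] at this
      rw [this, zero_add]
    rw [this]; linarith
  · have hpt : ∀ j ∈ s, k * (‖x j‖ + ‖y j‖) ^ 2 ≤
        (k + 1) * ‖x j‖ ^ 2 + (k + 1) * k * ‖y j‖ ^ 2 := by
      intro j _
      nlinarith [sq_nonneg (‖x j‖ - k * ‖y j‖)]
    have hs := Finset.sum_le_sum hpt
    rw [← Finset.mul_sum, Finset.sum_add_distrib, ← Finset.mul_sum, ← Finset.mul_sum] at hs
    have h1 : k * ∑ j ∈ s, (‖x j‖ + ‖y j‖) ^ 2 ≤ k * ((k + 1) * (A + B)) := by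
      have e1 := mul_le_mul_of_nonneg_left hx (by linarith : 0 ≤ k + 1)
      have e2 := mul_le_mul_of_nonneg_left hy (by positivity : 0 ≤ (k + 1) * k)
      nlinarith
    exact le_of_mul_le_mul_left h1 h

/-- partial energies -/
def energy {E : Type*} [SeminormedAddCommGroup E] (b0 b1 : ℕ → ℕ → E) (η i : ℕ) : ℝ :=
  ∑ u ∈ Finset.range i, (∑ j ∈ Finset.range η, ‖b0 u j‖ ^ 2 + ∑ j ∈ Finset.range η, ‖b1 u j‖ ^ 2)

theorem energy_nonneg {E : Type*} [SeminormedAddCommGroup E] (b0 b1 : ℕ → ℕ → E) (η i : ℕ) :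
    0 ≤ energy b0 b1 η i := by unfold energy; positivity

theorem energy_mono {E : Type*} [SeminormedAddCommGroup E] (b0 b1 : ℕ → ℕ → E) (η : ℕ)
    {i k : ℕ} (h : i ≤ k) : energy b0 b1 η i ≤ energy b0 b1 η k := by
  unfold energy
  refine Finset.sum_le_sum_of_subset_of_nonneg (by simpa using h) fun _ _ _ => by positivity

theorem drec_bound1 {E : Type*} [SeminormedAddCommGroup E] (b0 b1 : ℕ → ℕ → E) (η i : ℕ)
    (h : ∑ j ∈ Finset.range η, ‖drec b0 b1 i j‖ ^ 2 ≤ (2 * i : ℝ) * energy b0 b1 η i) :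
    ∑ j ∈ Finset.range η, ‖drec b0 b1 i j + b0 i j‖ ^ 2 ≤
      (2 * i + 1 : ℝ) * (energy b0 b1 η i + ∑ j ∈ Finset.range η, ‖b0 i j‖ ^ 2) :=
  sum_add_sq_le _ _ _ _ _ _ (by positivity) (energy_nonneg _ _ _ _) h le_rfl

theorem drec_bound {E : Type*} [NormedAddCommGroup E] (b0 b1 : ℕ → ℕ → E) (η : ℕ)
    (h0 : ∀ i j, η ≤ j → b0 i j = 0) (h1 : ∀ i j, η ≤ j → b1 i j = 0) (i : ℕ) :
    ∑ j ∈ Finset.range η, ‖drec b0 b1 i j‖ ^ 2 ≤ (2 * i : ℝ) * energy b0 b1 η i := by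
  induction i with
  | zero => simp [drec]
  | succ i ih =>
    have hb := drec_bound1 b0 b1 η i ih
    have hshift : ∑ j ∈ Finset.range η, ‖drec b0 b1 i (j+1) + b0 i (j+1)‖ ^ 2 ≤
        ∑ j ∈ Finset.range η, ‖drec b0 b1 i j + b0 i j‖ ^ 2 := by
      have e1 := Finset.sum_range_succ' (fun j => ‖drec b0 b1 i j + b0 i j‖ ^ 2) η
      have e2 := Finset.sum_range_succ (fun j => ‖drec b0 b1 i j + b0 i j‖ ^ 2) η
      rw [drec_zero b0 b1 η h0 h1 i η le_rfl, h0 i η le_rfl] at e2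
      simp only [add_zero, norm_zero] at e2
      have : 0 ≤ ‖drec b0 b1 i 0 + b0 i 0‖ ^ 2 := by positivity
      linarith
    have := sum_add_sq_le (Finset.range η) (fun j => drec b0 b1 i (j+1) + b0 i (j+1))
      (fun j => b1 i j) (2 * i + 1) _ _ (by positivity)
      (add_nonneg (energy_nonneg b0 b1 η i) (by positivity)) (hshift.trans hb) le_rfl
    simp only [drec]
    have e3 : energy b0 b1 η (i+1) = energy b0 b1 η i + ∑ j ∈ Finset.range η, ‖b0 i j‖ ^ 2
        + ∑ j ∈ Finset.range η, ‖b1 i j‖ ^ 2 := by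
      simp only [energy, Finset.sum_range_succ]; ring
    rw [e3]
    calc _ = ∑ j ∈ Finset.range η, ‖drec b0 b1 i (j+1) + b0 i (j+1) + b1 i j‖ ^ 2 := by
          refine Finset.sum_congr rfl fun j _ => by rw [add_comm]
      _ ≤ _ := this
      _ = _ := by push_cast; ring

theorem drec_total {E : Type*} [NormedAddCommGroup E] (b0 b1 : ℕ → ℕ → E) (ε η : ℕ)
    (h0 : ∀ i j, η ≤ j → b0 i j = 0) (h1 : ∀ i j, η ≤ j → b1 i j = 0) :
    ∑ i ∈ Finset.range ε, ∑ j ∈ Finset.range (η + 1), ‖-(drec b0 b1 i j + b0 i j)‖ ^ 2 +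
    ∑ i ∈ Finset.range (ε + 1), ∑ j ∈ Finset.range η, ‖drec b0 b1 i j‖ ^ 2 ≤
      2 * ((ε : ℝ) + 1) ^ 2 * energy b0 b1 η ε := by
  have a1 : ∀ i ∈ Finset.range ε,
      ∑ j ∈ Finset.range (η + 1), ‖-(drec b0 b1 i j + b0 i j)‖ ^ 2 ≤
        (2 * i + 1 : ℝ) * energy b0 b1 η ε := by
    intro i hi
    rw [Finset.sum_range_succ, drec_zero b0 b1 η h0 h1 i η le_rfl, h0 i η le_rfl]
    simp only [norm_neg, add_zero, norm_zero]
    have := drec_bound1 b0 b1 η i (drec_bound b0 b1 η h0 h1 i)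
    have e3 : energy b0 b1 η (i+1) = energy b0 b1 η i + ∑ j ∈ Finset.range η, ‖b0 i j‖ ^ 2
        + ∑ j ∈ Finset.range η, ‖b1 i j‖ ^ 2 := by
      simp only [energy, Finset.sum_range_succ]; ring
    have e4 : energy b0 b1 η (i+1) ≤ energy b0 b1 η ε :=
      energy_mono _ _ _ (by simpa using hi)
    have e5 : 0 ≤ ∑ j ∈ Finset.range η, ‖b1 i j‖ ^ 2 := by positivity
    have e6 : energy b0 b1 η i + ∑ j ∈ Finset.range η, ‖b0 i j‖ ^ 2 ≤ energy b0 b1 η ε := by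
      linarith
    have e7 := mul_le_mul_of_nonneg_left e6 (by positivity : (0:ℝ) ≤ 2 * i + 1)
    have e8 : (0:ℝ) ^ 2 = 0 := by norm_num
    linarith
  have a2 : ∀ i ∈ Finset.range (ε + 1),
      ∑ j ∈ Finset.range η, ‖drec b0 b1 i j‖ ^ 2 ≤ (2 * i : ℝ) * energy b0 b1 η ε := by
    intro i hi
    have e4 : energy b0 b1 η i ≤ energy b0 b1 η ε :=
      energy_mono _ _ _ (by have := Finset.mem_range.1 hi; omega)
    exact (drec_bound b0 b1 η h0 h1 i).trans (mul_le_mul_of_nonneg_left e4 (by positivity))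
  have s1 : ∀ k : ℕ, ∑ i ∈ Finset.range k, (2 * i + 1 : ℝ) = k ^ 2 := by
    intro k; induction k with
    | zero => simp
    | succ k ih => rw [Finset.sum_range_succ, ih]; push_cast; ring
  have s2 : ∀ k : ℕ, ∑ i ∈ Finset.range (k + 1), (2 * i : ℝ) = k ^ 2 + k := by
    intro k; induction k with
    | zero => simp
    | succ k ih => rw [Finset.sum_range_succ, ih]; push_cast; ring
  have b1' := Finset.sum_le_sum a1
  have b2' := Finset.sum_le_sum a2
  rw [← Finset.sum_mul, s1] at b1'
  rw [← Finset.sum_mul, s2] at b2'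
  have := energy_nonneg b0 b1 η ε
  have h5 : (0:ℝ) ≤ (ε : ℝ) * energy b0 b1 η ε := by positivity
  nlinarith

/-- abstract fixed point -/
theorem fp_exists (𝕂 : Type*) [RCLike 𝕂] {X Y : Type*} [NormedAddCommGroup X] [NormedSpace 𝕂 X]
    [FiniteDimensional 𝕂 X] [NormedAddCommGroup Y]
    (S : Y → X) (hS : ∀ y z, S y - S z = S (y - z)) (s : ℝ) (hs : 0 ≤ s)
    (hSn : ∀ y, ‖S y‖ ≤ s * ‖y‖) (F : X → Y) (r R κ : ℝ) (hr : 0 ≤ r)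
    (hF : ∀ x, ‖x‖ ≤ r → ‖F x‖ ≤ R) (hκ : 0 ≤ κ)
    (hL : ∀ x y, ‖x‖ ≤ r → ‖y‖ ≤ r → ‖F x - F y‖ ≤ κ * ‖x - y‖)
    (h1 : s * R ≤ r) (h2 : s * κ < 1) :
    ∃ x, ‖x‖ ≤ r ∧ S (F x) = x := by
  have hcomplete : CompleteSpace X := FiniteDimensional.complete 𝕂 X
  have hmaps : Set.MapsTo (fun x => S (F x)) (Metric.closedBall (0 : X) r)
      (Metric.closedBall (0 : X) r) := by
    intro x hx
    rw [mem_closedBall_zero_iff] at hx ⊢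
    exact (hSn _).trans ((mul_le_mul_of_nonneg_left (hF x hx) hs).trans h1)
  obtain ⟨K, hK⟩ : ∃ K : NNReal, (K : ℝ) = s * κ := ⟨⟨s * κ, mul_nonneg hs hκ⟩, rfl⟩
  have hc : ContractingWith K
      (hmaps.restrict (fun x => S (F x)) _ _) := by
    refine ⟨by rw [← NNReal.coe_lt_coe, hK]; exact_mod_cast h2, LipschitzWith.of_dist_le_mul ?_⟩
    rintro ⟨x, hx⟩ ⟨y, hy⟩
    rw [mem_closedBall_zero_iff] at hx hy
    rw [Subtype.dist_eq, Subtype.dist_eq, dist_eq_norm, dist_eq_norm]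
    simp only [Set.MapsTo.val_restrict_apply, hS]
    refine (hSn _).trans ?_
    rw [hK, mul_assoc]
    exact mul_le_mul_of_nonneg_left (hL x y hx hy) hs
  obtain ⟨x, hx, hfix, -⟩ := hc.exists_fixedPoint' (Metric.isClosed_closedBall.isComplete) hmaps
    (x := 0) (by simpa using hr) (edist_ne_top _ _)
  exact ⟨x, by simpa using hx, hfix⟩

theorem sq_le_helper {a b : ℝ} (h : a ^ 2 ≤ b ^ 2) (hb : 0 ≤ b) : a ≤ b :=
  (le_abs_self _).trans (abs_le_of_sq_le_sq h hb)

section frob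
set_option linter.unusedSectionVars false
open scoped Matrix.Norms.Frobenius

variable {𝕂 : Type*} [RCLike 𝕂] {ι κ τ : Type*} [Fintype ι] [Fintype κ] [Fintype τ]

theorem frob_sq (A : Matrix ι κ 𝕂) : ‖A‖ ^ 2 = ∑ i, ∑ j, ‖A i j‖ ^ 2 := by
  rw [Matrix.frobenius_norm_def, ← Real.sqrt_eq_rpow, Real.sq_sqrt]
  · simp
  · positivity

theorem frobNorm_eq (A : Matrix ι κ 𝕂) : frobNorm A = ‖A‖ := by
  rw [frobNorm, ← frob_sq, Real.sqrt_sq (norm_nonneg _)]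

/-- coefficient matrix -/
noncomputable def co (k : ℕ) (P : Matrix ι κ 𝕂[X]) : Matrix ι κ 𝕂 := P.map (fun p => p.coeff k)

/-- coefficient pair of a pencil -/
noncomputable def toY (P : Matrix ι κ 𝕂[X]) : WithLp 2 (Matrix ι κ 𝕂 × Matrix ι κ 𝕂) :=
  WithLp.toLp 2 (co 0 P, co 1 P)

theorem toY_sq (P : Matrix ι κ 𝕂[X]) : ‖toY P‖ ^ 2 = ‖co 0 P‖ ^ 2 + ‖co 1 P‖ ^ 2 :=
  WithLp.prod_norm_sq_eq_of_L2 _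

theorem co_add (k : ℕ) (P Q : Matrix ι κ 𝕂[X]) : co k (P + Q) = co k P + co k Q := by
  ext i j; simp [co]

theorem co_neg (k : ℕ) (P : Matrix ι κ 𝕂[X]) : co k (-P) = - co k P := by
  ext i j; simp [co]

theorem co_cmul (k : ℕ) (A : Matrix ι κ 𝕂) (P : Matrix κ τ 𝕂[X]) :
    co k (A.map Polynomial.C * P) = A * co k P := by
  ext i j; simp [co, Matrix.mul_apply]

theorem co_mulc (k : ℕ) (P : Matrix ι κ 𝕂[X]) (A : Matrix κ τ 𝕂) :
    co k (P * A.map Polynomial.C) = co k P * A := by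
  ext i j; simp [co, Matrix.mul_apply]

theorem toY_add (P Q : Matrix ι κ 𝕂[X]) : toY (P + Q) = toY P + toY Q := by
  simp only [toY, co_add]; rfl

theorem toY_neg (P : Matrix ι κ 𝕂[X]) : toY (-P) = - toY P := by
  simp only [toY, co_neg]; rfl

theorem toY_sub (P Q : Matrix ι κ 𝕂[X]) : toY (P - Q) = toY P - toY Q := by
  rw [sub_eq_add_neg, toY_add, toY_neg, sub_eq_add_neg]

theorem toY_cmul (A : Matrix ι κ 𝕂) (P : Matrix κ τ 𝕂[X]) :
    ‖toY (A.map Polynomial.C * P)‖ ≤ ‖A‖ * ‖toY P‖ := by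
  refine sq_le_helper ?_ (by positivity)
  rw [mul_pow, toY_sq, toY_sq, co_cmul, co_cmul, mul_add, ← mul_pow, ← mul_pow]
  gcongr <;> exact Matrix.frobenius_norm_mul _ _

theorem toY_mulc (P : Matrix ι κ 𝕂[X]) (A : Matrix κ τ 𝕂) :
    ‖toY (P * A.map Polynomial.C)‖ ≤ ‖toY P‖ * ‖A‖ := by
  refine sq_le_helper ?_ (by positivity)
  rw [mul_pow, toY_sq, toY_sq, co_mulc, co_mulc, add_mul, ← mul_pow, ← mul_pow]
  gcongr <;> exact Matrix.frobenius_norm_mul _ _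

theorem toY_sq' (P : Matrix ι κ 𝕂[X]) :
    ‖toY P‖ ^ 2 = ∑ i, ∑ j, (‖(P i j).coeff 0‖ ^ 2 + ‖(P i j).coeff 1‖ ^ 2) := by
  rw [toY_sq, frob_sq, frob_sq]
  simp only [co, Matrix.map_apply, Finset.sum_add_distrib]

theorem polyFrob_eq (P : Matrix ι κ 𝕂[X]) (hP : ∀ i j, (P i j).natDegree ≤ 1) :
    polyFrob P = ‖toY P‖ := by
  rw [← Real.sqrt_sq (norm_nonneg (toY P)), toY_sq', polyFrob]
  congr 1
  refine Finset.sum_congr rfl fun i _ => Finset.sum_congr rfl fun j _ => ?_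
  have hsub : (P i j).support ⊆ Finset.range 2 := by
    intro k hk
    have := Polynomial.le_natDegree_of_mem_supp k hk
    have := hP i j
    simp; omega
  rw [Finset.sum_subset hsub]
  · simp [Finset.sum_range_succ]
  · intro k _ hk
    simp [Polynomial.notMem_support_iff.1 hk]

theorem eq_zero_of_toY (P : Matrix ι κ 𝕂[X]) (hP : ∀ i j, (P i j).natDegree ≤ 1)
    (h : toY P = 0) : P = 0 := by
  have h2 : ‖toY P‖ ^ 2 = 0 := by rw [h]; simp
  rw [toY_sq] at h2
  have h0 : co 0 P = 0 := by
    have : ‖co 0 P‖ ^ 2 = 0 := by nlinarith [sq_nonneg ‖co 0 P‖, sq_nonneg ‖co 1 P‖]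
    simpa using this
  have h1 : co 1 P = 0 := by
    have : ‖co 1 P‖ ^ 2 = 0 := by nlinarith [sq_nonneg ‖co 0 P‖, sq_nonneg ‖co 1 P‖]
    simpa using this
  ext i j k
  have e0 := congrFun (congrFun h0 i) j
  have e1 := congrFun (congrFun h1 i) j
  simp only [co, Matrix.map_apply, Matrix.zero_apply] at e0 e1 ⊢
  rcases k with _ | _ | k
  · simpa using e0
  · simpa using e1
  · rw [Polynomial.coeff_eq_zero_of_natDegree_lt (by have := hP i j; omega)]; simp

theorem deg_add (P Q : Matrix ι κ 𝕂[X]) (hP : ∀ i j, (P i j).natDegree ≤ 1)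
    (hQ : ∀ i j, (Q i j).natDegree ≤ 1) (i j) : ((P + Q) i j).natDegree ≤ 1 := by
  rw [Matrix.add_apply]
  exact Polynomial.natDegree_add_le_of_degree_le (hP i j) (hQ i j)

theorem deg_cmul (A : Matrix ι κ 𝕂) (P : Matrix κ τ 𝕂[X]) (hP : ∀ i j, (P i j).natDegree ≤ 1)
    (i j) : ((A.map Polynomial.C * P) i j).natDegree ≤ 1 := by
  rw [Matrix.mul_apply]
  refine Polynomial.natDegree_sum_le_of_forall_le _ _ fun k _ => ?_
  exact (Polynomial.natDegree_C_mul_le _ _).trans (hP k j)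

theorem deg_mulc (P : Matrix ι κ 𝕂[X]) (A : Matrix κ τ 𝕂) (hP : ∀ i j, (P i j).natDegree ≤ 1)
    (i j) : ((P * A.map Polynomial.C) i j).natDegree ≤ 1 := by
  rw [Matrix.mul_apply]
  refine Polynomial.natDegree_sum_le_of_forall_le _ _ fun k _ => ?_
  exact (Polynomial.natDegree_mul_C_le _ _).trans (hP i k)

theorem co0_Lk (k : ℕ) (i : Fin k) (j : Fin (k + 1)) :
    (Lk 𝕂 k i j).coeff 0 = if j = i.castSucc then -1 else 0 := by
  simp only [Lk, Matrix.of_apply, Fin.ext_iff, Fin.val_castSucc]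
  split_ifs <;> simp

theorem co1_Lk (k : ℕ) (i : Fin k) (j : Fin (k + 1)) :
    (Lk 𝕂 k i j).coeff 1 = if j = i.succ then 1 else 0 := by
  simp only [Lk, Matrix.of_apply, Fin.ext_iff, Fin.val_succ]
  split_ifs <;> first | omega | simp [Polynomial.coeff_one]

theorem deg_Lk (k : ℕ) (i : Fin k) (j : Fin (k + 1)) : (Lk 𝕂 k i j).natDegree ≤ 1 := by
  simp only [Lk, Matrix.of_apply]
  split_ifs <;> simp

theorem deg_kron {l : ℕ} (P : Matrix ι κ 𝕂[X]) (hP : ∀ i j, (P i j).natDegree ≤ 1) (i j) :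
    ((P ⊗ₖ (1 : Matrix (Fin l) (Fin l) 𝕂[X])) i j).natDegree ≤ 1 := by
  rw [Matrix.kroneckerMap_apply, Matrix.one_apply]
  split_ifs
  · simpa using hP _ _
  · simp

theorem co_kron {l : ℕ} (k : ℕ) (P : Matrix ι κ 𝕂[X]) (i j) :
    co k (P ⊗ₖ (1 : Matrix (Fin l) (Fin l) 𝕂[X])) i j =
      if i.2 = j.2 then (P i.1 j.1).coeff k else 0 := by
  rw [co, Matrix.map_apply, Matrix.kroneckerMap_apply, Matrix.one_apply]
  split_ifs <;> simp

theorem T_C0 {η m : ℕ} (A : Matrix ι (Fin (η + 1) × Fin m) 𝕂) (i j) :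
    (A * co 0 ((Lk 𝕂 η).transpose ⊗ₖ (1 : Matrix (Fin m) (Fin m) 𝕂[X]))) i j =
      - A i (j.1.castSucc, j.2) := by
  simp [Matrix.mul_apply, co_kron, co0_Lk, Fintype.sum_prod_type]

theorem T_C1 {η m : ℕ} (A : Matrix ι (Fin (η + 1) × Fin m) 𝕂) (i j) :
    (A * co 1 ((Lk 𝕂 η).transpose ⊗ₖ (1 : Matrix (Fin m) (Fin m) 𝕂[X]))) i j =
      A i (j.1.succ, j.2) := by
  simp [Matrix.mul_apply, co_kron, co1_Lk, Fintype.sum_prod_type]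

theorem T_D0 {η m : ℕ} (A : Matrix (Fin (η + 1) × Fin m) ι 𝕂) (i j) :
    (co 0 ((Lk 𝕂 η) ⊗ₖ (1 : Matrix (Fin m) (Fin m) 𝕂[X])) * A) j i =
      - A (j.1.castSucc, j.2) i := by
  simp [Matrix.mul_apply, co_kron, co0_Lk, Fintype.sum_prod_type]

theorem T_D1 {η m : ℕ} (A : Matrix (Fin (η + 1) × Fin m) ι 𝕂) (i j) :
    (co 1 ((Lk 𝕂 η) ⊗ₖ (1 : Matrix (Fin m) (Fin m) 𝕂[X])) * A) j i =
      A (j.1.succ, j.2) i := by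
  simp [Matrix.mul_apply, co_kron, co1_Lk, Fintype.sum_prod_type]

/-- zero extension of the blocks -/
def bext {ε n η m : ℕ} (B : Matrix (Fin ε × Fin n) (Fin η × Fin m) 𝕂) (p : Fin n) (q : Fin m)
    (i j : ℕ) : 𝕂 :=
  if h : i < ε ∧ j < η then B (⟨i, h.1⟩, p) (⟨j, h.2⟩, q) else 0

theorem bext_sub {ε n η m : ℕ} (A B : Matrix (Fin ε × Fin n) (Fin η × Fin m) 𝕂) (p : Fin n)
    (q : Fin m) : bext (A - B) p q = fun i j => bext A p q i j - bext B p q i j := by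
  funext i j; unfold bext; split_ifs <;> simp

theorem bext_zero {ε n η m : ℕ} (B : Matrix (Fin ε × Fin n) (Fin η × Fin m) 𝕂) (p : Fin n)
    (q : Fin m) (i j : ℕ) (h : η ≤ j) : bext B p q i j = 0 := by
  unfold bext; rw [dif_neg (by omega)]

theorem bext_fin {ε n η m : ℕ} (B : Matrix (Fin ε × Fin n) (Fin η × Fin m) 𝕂) (p : Fin n)
    (q : Fin m) (i : Fin ε) (j : Fin η) : bext B p q i j = B (i, p) (j, q) := by
  unfold bext; rw [dif_pos ⟨i.2, j.2⟩]

/-- the right inverse -/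
def Sinv {ε n η m : ℕ}
    (y : WithLp 2 (Matrix (Fin ε × Fin n) (Fin η × Fin m) 𝕂 ×
      Matrix (Fin ε × Fin n) (Fin η × Fin m) 𝕂)) :
    WithLp 2 (Matrix (Fin ε × Fin n) (Fin (η + 1) × Fin m) 𝕂 ×
      Matrix (Fin (ε + 1) × Fin n) (Fin η × Fin m) 𝕂) :=
  WithLp.toLp 2
    (Matrix.of fun a b => -(drec (bext y.fst a.2 b.2) (bext y.snd a.2 b.2) a.1 b.1
        + bext y.fst a.2 b.2 a.1 b.1),
     Matrix.of fun a b => drec (bext y.fst a.2 b.2) (bext y.snd a.2 b.2) a.1 b.1)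

theorem Sinv_fst {ε n η m : ℕ}
    (y : WithLp 2 (Matrix (Fin ε × Fin n) (Fin η × Fin m) 𝕂 ×
      Matrix (Fin ε × Fin n) (Fin η × Fin m) 𝕂)) (a b) :
    (Sinv y).fst a b = -(drec (bext y.fst a.2 b.2) (bext y.snd a.2 b.2) a.1 b.1
        + bext y.fst a.2 b.2 a.1 b.1) := rfl

theorem Sinv_snd {ε n η m : ℕ}
    (y : WithLp 2 (Matrix (Fin ε × Fin n) (Fin η × Fin m) 𝕂 ×
      Matrix (Fin ε × Fin n) (Fin η × Fin m) 𝕂)) (a b) :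
    (Sinv y).snd a b = drec (bext y.fst a.2 b.2) (bext y.snd a.2 b.2) a.1 b.1 := rfl

theorem Sinv_sub {ε n η m : ℕ}
    (y z : WithLp 2 (Matrix (Fin ε × Fin n) (Fin η × Fin m) 𝕂 ×
      Matrix (Fin ε × Fin n) (Fin η × Fin m) 𝕂)) : Sinv y - Sinv z = Sinv (y - z) := by
  unfold Sinv
  rw [← WithLp.toLp_sub]
  congr 1
  refine Prod.ext ?_ ?_
  · ext a b
    simp only [WithLp.sub_fst, WithLp.sub_snd, bext_sub, drec_sub, Prod.fst_sub, Matrix.sub_apply,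
      Matrix.of_apply]
    abel
  · ext a b
    simp only [WithLp.sub_fst, WithLp.sub_snd, bext_sub, drec_sub, Prod.snd_sub, Matrix.sub_apply,
      Matrix.of_apply]

theorem T_Sinv {ε n η m : ℕ}
    (y : WithLp 2 (Matrix (Fin ε × Fin n) (Fin η × Fin m) 𝕂 ×
      Matrix (Fin ε × Fin n) (Fin η × Fin m) 𝕂)) :
    toY ((Sinv y).fst.map Polynomial.C *
        ((Lk 𝕂 η).transpose ⊗ₖ (1 : Matrix (Fin m) (Fin m) 𝕂[X])) +
      ((Lk 𝕂 ε) ⊗ₖ (1 : Matrix (Fin n) (Fin n) 𝕂[X])) * (Sinv y).snd.map Polynomial.C) = y := by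
  unfold toY
  rw [co_add, co_add, co_cmul, co_cmul, co_mulc, co_mulc]
  refine WithLp.ofLp_injective 2 (Prod.ext ?_ ?_)
  · ext ⟨i, p⟩ ⟨j, q⟩
    simp only [Matrix.add_apply, T_C0, T_D0]
    simp only [Sinv_fst, Sinv_snd, Fin.val_castSucc, bext_fin]
    show _ = y.fst (i, p) (j, q)
    ring
  · ext ⟨i, p⟩ ⟨j, q⟩
    simp only [Matrix.add_apply, T_C1, T_D1]
    simp only [Sinv_fst, Sinv_snd, Fin.val_succ, drec, bext_fin]
    show _ = y.snd (i, p) (j, q)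
    ring

theorem sum_reorg {a b c e : ℕ} (f : Fin b → Fin e → ℕ → ℕ → ℝ) :
    ∑ x : Fin a × Fin b, ∑ y : Fin c × Fin e, f x.2 y.2 x.1 y.1 =
      ∑ p, ∑ q, ∑ i ∈ Finset.range a, ∑ j ∈ Finset.range c, f p q i j := by
  rw [Fintype.sum_prod_type_right]
  refine Finset.sum_congr rfl fun p _ => ?_
  simp only [Fintype.sum_prod_type_right]
  rw [Finset.sum_comm]
  refine Finset.sum_congr rfl fun q _ => ?_
  rw [Finset.sum_range]
  refine Finset.sum_congr rfl fun i _ => ?_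
  rw [Finset.sum_range]

theorem Sinv_bound {ε n η m : ℕ}
    (y : WithLp 2 (Matrix (Fin ε × Fin n) (Fin η × Fin m) 𝕂 ×
      Matrix (Fin ε × Fin n) (Fin η × Fin m) 𝕂)) :
    ‖Sinv y‖ ≤ Real.sqrt 2 * ((ε : ℝ) + 1) * ‖y‖ := by
  refine sq_le_helper ?_ (by positivity)
  rw [mul_pow, mul_pow, Real.sq_sqrt (by norm_num), WithLp.prod_norm_sq_eq_of_L2,
    WithLp.prod_norm_sq_eq_of_L2, frob_sq, frob_sq]
  have hy : ‖y.fst‖ ^ 2 + ‖y.snd‖ ^ 2 =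
      ∑ p, ∑ q, energy (bext y.fst p q) (bext y.snd p q) η ε := by
    have hB : ∀ B : Matrix (Fin ε × Fin n) (Fin η × Fin m) 𝕂, ‖B‖ ^ 2 =
        ∑ p, ∑ q, ∑ i ∈ Finset.range ε, ∑ j ∈ Finset.range η, ‖bext B p q i j‖ ^ 2 := by
      intro B
      rw [frob_sq, ← sum_reorg]
      refine Finset.sum_congr rfl fun x _ => Finset.sum_congr rfl fun z _ => ?_
      rw [bext_fin]
    rw [hB, hB]
    simp only [energy, Finset.sum_add_distrib]
  rw [hy]
  simp only [Sinv_fst, Sinv_snd]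
  have r1 := sum_reorg (a := ε) (c := η + 1)
    (fun (p : Fin n) (q : Fin m) i j => ‖-(drec (bext y.fst p q) (bext y.snd p q) i j
        + bext y.fst p q i j)‖ ^ 2)
  have r2 := sum_reorg (a := ε + 1) (c := η)
    (fun (p : Fin n) (q : Fin m) i j => ‖drec (bext y.fst p q) (bext y.snd p q) i j‖ ^ 2)
  rw [r1, r2, ← Finset.sum_add_distrib, Finset.mul_sum]
  refine Finset.sum_le_sum fun p _ => ?_
  rw [← Finset.sum_add_distrib, Finset.mul_sum]
  refine Finset.sum_le_sum fun q _ => ?_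
  exact drec_total _ _ ε η (fun i j h => bext_zero _ _ _ i j h) (fun i j h => bext_zero _ _ _ i j h)

theorem toY_blocks {ι' κ' : Type*} [Fintype ι'] [Fintype κ']
    (P : Matrix (ι ⊕ ι') (κ ⊕ κ') 𝕂[X]) :
    ‖toY P‖ ^ 2 = ‖toY P.toBlocks₁₁‖ ^ 2 + ‖toY P.toBlocks₁₂‖ ^ 2 +
      (‖toY P.toBlocks₂₁‖ ^ 2 + ‖toY P.toBlocks₂₂‖ ^ 2) := by
  simp only [toY_sq', Fintype.sum_sum_type, Finset.sum_add_distrib, Matrix.toBlocks₁₁,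
    Matrix.toBlocks₁₂, Matrix.toBlocks₂₁, Matrix.toBlocks₂₂, Matrix.of_apply]
  ring

end frob

theorem cs_real {p q a b P A : ℝ} (h1 : p ^ 2 + q ^ 2 ≤ P ^ 2) (h2 : a ^ 2 + b ^ 2 ≤ A ^ 2)
    (hP : 0 ≤ P) (hA : 0 ≤ A) : p * a + q * b ≤ P * A := by
  refine (le_abs_self _).trans (abs_le_of_sq_le_sq ?_ (by positivity))
  have := mul_le_mul h1 h2 (by positivity) (by positivity)
  nlinarith [sq_nonneg (p * b - q * a)]

theorem arith_self {δ μ d a : ℝ} (hδ : 0 ≤ δ) (hμ : 0 ≤ μ) (hd : 3 ≤ d)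
    (ha : a = Real.sqrt 2 - 1) (hs : δ < (a / d) ^ 2 * (1 / (1 + μ))) :
    (d * δ / a) * (μ + δ) ≤ a / d ∧ d * δ / a ≤ a / d ∧ δ ≤ (a / d) ^ 2 := by
  have h2 : Real.sqrt 2 ^ 2 = 2 := Real.sq_sqrt (by norm_num)
  have h2a : (1.414 : ℝ) < Real.sqrt 2 := by
    rw [Real.lt_sqrt (by norm_num)]; norm_num
  have h2b : Real.sqrt 2 < 1.4143 := by
    rw [Real.sqrt_lt' (by norm_num)]; norm_num
  have ha0 : 0 < a := by linarith
  have hd0 : 0 < d := by linarith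
  have hmul : δ * (1 + μ) ≤ (a / d) ^ 2 := by
    have := hs.le
    rw [mul_one_div, le_div_iff₀ (by linarith)] at this
    exact this
  have hδμ : 0 ≤ δ * μ := mul_nonneg hδ hμ
  have had : a / d ≤ 1 := by rw [div_le_one hd0]; linarith
  have had0 : 0 < a / d := by positivity
  have hδ1 : δ ≤ (a / d) ^ 2 := by nlinarith
  have hδ2 : δ ≤ 1 := by nlinarith
  have e : d * δ / a = δ / (a / d) := by field_simp
  rw [e]
  refine ⟨?_, ?_, hδ1⟩
  · rw [div_mul_eq_mul_div, div_le_iff₀ had0]; nlinarith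
  · rw [div_le_iff₀ had0]; nlinarith

section main
open scoped Matrix.Norms.Frobenius

/-- the space of pairs -/
abbrev PX (𝕂 : Type*) (ε n η m : ℕ) := WithLp 2 (Matrix (Fin ε × Fin n) (Fin (η + 1) × Fin m) 𝕂 ×
      Matrix (Fin (ε + 1) × Fin n) (Fin η × Fin m) 𝕂)

set_option maxHeartbeats 2000000 in
theorem main_exists {𝕂 : Type*} [RCLike 𝕂] (m n ε η : ℕ) (d a δ μ r ν : ℝ)
    (hd : 3 ≤ d) (hεd : (ε : ℝ) + 1 ≤ d) (ha : a = Real.sqrt 2 - 1) (hδ : 0 ≤ δ) (hμ : 0 ≤ μ)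
    (hr : r = d * δ / a) (hν : ν = μ + δ) (hs : δ < (a / d) ^ 2 * (1 / (1 + μ)))
    (N : Matrix (Fin (η + 1) × Fin m) (Fin (ε + 1) × Fin n) 𝕂[X])
    (U : Matrix (Fin (η + 1) × Fin m) (Fin η × Fin m) 𝕂[X])
    (V : Matrix (Fin ε × Fin n) (Fin (ε + 1) × Fin n) 𝕂[X])
    (W : Matrix (Fin ε × Fin n) (Fin η × Fin m) 𝕂[X])
    (hN : ‖toY N‖ ≤ ν) (hUV : ‖toY U‖ ^ 2 + ‖toY V‖ ^ 2 ≤ δ ^ 2) (hW : ‖toY W‖ ≤ δ) :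
    ∃ (C : Matrix (Fin ε × Fin n) (Fin (η + 1) × Fin m) 𝕂)
      (D : Matrix (Fin (ε + 1) × Fin n) (Fin η × Fin m) 𝕂),
      ‖C‖ ^ 2 + ‖D‖ ^ 2 ≤ r ^ 2 ∧
      toY (C.map Polynomial.C * ((Lk 𝕂 η).transpose ⊗ₖ (1 : Matrix (Fin m) (Fin m) 𝕂[X])) +
        ((Lk 𝕂 ε) ⊗ₖ (1 : Matrix (Fin n) (Fin n) 𝕂[X])) * D.map Polynomial.C +
        (W + C.map Polynomial.C * U + V * D.map Polynomial.C +
          C.map Polynomial.C * N * D.map Polynomial.C)) = 0 := by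
  obtain ⟨h1, h2, h3⟩ := arith_self hδ hμ hd ha hs
  rw [← hr, ← hν] at h1
  rw [← hr] at h2
  have hsq : Real.sqrt 2 ^ 2 = 2 := Real.sq_sqrt (by norm_num)
  have h2a : (1.414 : ℝ) < Real.sqrt 2 := by
    rw [Real.lt_sqrt (by norm_num)]; norm_num
  have h2b : Real.sqrt 2 < 1.4143 := by
    rw [Real.sqrt_lt' (by norm_num)]; norm_num
  have ha0 : 0 < a := by linarith
  have hd0 : 0 < d := by linarith
  have hr0 : 0 ≤ r := by rw [hr]; positivity
  have hν0 : 0 ≤ ν := by linarith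
  let G : PX 𝕂 ε n η m → Matrix (Fin ε × Fin n) (Fin η × Fin m) 𝕂[X] := fun x =>
    W + x.fst.map Polynomial.C * U + V * x.snd.map Polynomial.C +
          x.fst.map Polynomial.C * N * x.snd.map Polynomial.C
  have hXsq : ∀ x : PX 𝕂 ε n η m, ‖x.fst‖ ^ 2 + ‖x.snd‖ ^ 2 = ‖x‖ ^ 2 := fun x =>
    (WithLp.prod_norm_sq_eq_of_L2 x).symm
  have hlin : ∀ x : PX 𝕂 ε n η m, ‖toY (x.fst.map Polynomial.C * U)‖ + ‖toY (V * x.snd.map Polynomial.C)‖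
      ≤ ‖x‖ * δ := by
    intro x
    have e1 := toY_cmul x.fst U
    have e2 := toY_mulc V x.snd
    have := cs_real (hXsq x).le hUV (norm_nonneg _) hδ
    rw [mul_comm ‖toY V‖] at e2
    linarith
  have hbil : ∀ (A : Matrix (Fin ε × Fin n) (Fin (η + 1) × Fin m) 𝕂)
      (B : Matrix (Fin (ε + 1) × Fin n) (Fin η × Fin m) 𝕂),
      ‖toY (A.map Polynomial.C * N * B.map Polynomial.C)‖ ≤ ν * (‖A‖ * ‖B‖) := by
    intro A B
    calc _ ≤ ‖toY (A.map Polynomial.C * N)‖ * ‖B‖ := toY_mulc _ _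
      _ ≤ (‖A‖ * ‖toY N‖) * ‖B‖ := by gcongr; exact toY_cmul _ _
      _ ≤ (‖A‖ * ν) * ‖B‖ := by gcongr
      _ = _ := by ring
  have hF : ∀ x : PX 𝕂 ε n η m, ‖x‖ ≤ r → ‖-toY (G x)‖ ≤ δ + r * δ + ν * (r ^ 2 / 2) := by
    intro x hx
    rw [norm_neg]
    have e0 : ‖toY (G x)‖ ≤ ‖toY W‖ + ‖toY (x.fst.map Polynomial.C * U)‖ +
        ‖toY (V * x.snd.map Polynomial.C)‖ +
        ‖toY (x.fst.map Polynomial.C * N * x.snd.map Polynomial.C)‖ := by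
      simp only [G, toY_add]
      exact norm_add₄_le
    have e1 := hlin x
    have e2 := hbil x.fst x.snd
    have e3 : ‖x.fst‖ * ‖x.snd‖ ≤ r ^ 2 / 2 := by
      have := hXsq x
      have : ‖x‖ ^ 2 ≤ r ^ 2 := by gcongr
      nlinarith [sq_nonneg (‖x.fst‖ - ‖x.snd‖)]
    have e4 := mul_le_mul_of_nonneg_left e3 hν0
    have e5 := mul_le_mul_of_nonneg_right hx hδ
    linarith
  have hL : ∀ x y : PX 𝕂 ε n η m, ‖x‖ ≤ r → ‖y‖ ≤ r →
      ‖-toY (G x) - -toY (G y)‖ ≤ (δ + ν * (Real.sqrt 2 * r)) * ‖x - y‖ := by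
    intro x y hx hy
    have e : -toY (G x) - -toY (G y) = - (toY ((x - y).fst.map Polynomial.C * U) +
        toY (V * (x - y).snd.map Polynomial.C) +
        toY ((x - y).fst.map Polynomial.C * N * x.snd.map Polynomial.C) +
        toY (y.fst.map Polynomial.C * N * (x - y).snd.map Polynomial.C)) := by
      rw [← toY_add, ← toY_add, ← toY_add, ← toY_neg, ← toY_neg, ← toY_neg, ← toY_sub]
      congr 1
      have m1 : (x - y).fst.map Polynomial.C =
          x.fst.map Polynomial.C - y.fst.map Polynomial.C := by
        ext i j; simp [WithLp.sub_fst, WithLp.sub_snd]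
      have m2 : (x - y).snd.map Polynomial.C =
          x.snd.map Polynomial.C - y.snd.map Polynomial.C := by
        ext i j; simp [WithLp.sub_fst, WithLp.sub_snd]
      rw [m1, m2]
      simp only [G, Matrix.sub_mul, Matrix.mul_sub]
      abel
    rw [e, norm_neg]
    refine norm_add₄_le.trans ?_
    have e1 := hlin (x - y)
    have e2 := hbil (x - y).fst x.snd
    have e3 := hbil y.fst (x - y).snd
    have hx2 : ‖x.snd‖ ^ 2 + ‖y.fst‖ ^ 2 ≤ (Real.sqrt 2 * r) ^ 2 := by
      have := hXsq x
      have := hXsq y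
      have : ‖x‖ ^ 2 ≤ r ^ 2 := by gcongr
      have : ‖y‖ ^ 2 ≤ r ^ 2 := by gcongr
      rw [mul_pow, hsq]
      nlinarith [sq_nonneg ‖x.fst‖, sq_nonneg ‖y.snd‖]
    have e4 := cs_real (hXsq (x - y)).le hx2 (norm_nonneg _) (by positivity)
    have e5 := mul_le_mul_of_nonneg_left e4 hν0
    rw [mul_comm ‖y.fst‖] at e3
    linarith
  have hsr : Real.sqrt 2 * d * (δ + r * δ + ν * (r ^ 2 / 2)) ≤ r := by
    have q1 : ν * r ^ 2 ≤ δ := by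
      have : r * ν * r ≤ a / d * r := by gcongr
      have e : a / d * r = δ := by rw [hr]; field_simp
      nlinarith
    have q2 : r ≤ 0.14 := by
      refine h2.trans ?_
      rw [div_le_iff₀ hd0]; linarith
    have q3 : r = (Real.sqrt 2 + 1) * (d * δ) := by
      rw [hr, div_eq_iff ha0.ne', ha]; linear_combination (-(d * δ)) * hsq
    have q4 : 0 ≤ d * δ := by positivity
    have q5 : δ + r * δ + ν * (r ^ 2 / 2) ≤ 1.64 * δ := by nlinarith
    have q6 : Real.sqrt 2 * d * (δ + r * δ + ν * (r ^ 2 / 2)) ≤ Real.sqrt 2 * d * (1.64 * δ) := by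
      gcongr
    rw [q3] at q6 ⊢
    nlinarith
  have hκ : Real.sqrt 2 * d * (δ + ν * (Real.sqrt 2 * r)) < 1 := by
    have q1 : d * δ ≤ a * (a / d) := by
      have : d * δ ≤ d * (a / d) ^ 2 := by gcongr
      have e : d * (a / d) ^ 2 = a * (a / d) := by field_simp
      linarith
    have q2 : a / d ≤ 0.14 := by
      rw [div_le_iff₀ hd0]; linarith
    have q3 : d * (r * ν) ≤ a := by
      have : d * (r * ν) ≤ d * (a / d) := by gcongr
      have e : d * (a / d) = a := by field_simp
      linarith
    have q4 : d * δ ≤ 0.0581 := by nlinarith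
    have : Real.sqrt 2 * d * (δ + ν * (Real.sqrt 2 * r)) =
        Real.sqrt 2 * (d * δ) + Real.sqrt 2 ^ 2 * (d * (r * ν)) := by ring
    rw [this, hsq]
    nlinarith
  obtain ⟨x, hx, hfix⟩ := fp_exists 𝕂 (X := PX 𝕂 ε n η m) Sinv Sinv_sub (Real.sqrt 2 * d) (by positivity)
    (fun y => (Sinv_bound y).trans (by gcongr)) (fun x => -toY (G x)) r _ _ hr0 hF
    (by positivity) hL hsr hκ
  refine ⟨x.fst, x.snd, ?_, ?_⟩
  · rw [hXsq]; gcongr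
  · have := T_Sinv (-toY (G x))
    rw [toY_add]
    rw [hfix] at this
    rw [this]
    exact neg_add_cancel _


/-- **Theorem `thm:finalofstep1` of the paper.** If `ΔL(λ)` is a sufficiently
small pencil perturbation of the `(ε,n,η,m)`-block Kronecker pencil `L(λ)`, then there are
constant matrices `C, D` with `sqrt(‖C‖_F²+‖D‖_F²) ≤ d‖ΔL‖_F/(√2−1)` such that the strict
equivalence `[[I,0],[C,I]]·(L+ΔL)·[[I,D],[0,I]]` restores the zero `(2,2)` block, i.e. equals
`[[λM₁+M₀+ΔL₁₁, L_ηᵀ⊗I_m+ΔL̃₁₂],[L_ε⊗I_n+ΔL̃₂₁, 0]]`, with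
`max{‖ΔL̃₂₁‖_F, ‖ΔL̃₁₂‖_F} ≤ ‖ΔL‖_F(1 + d/(√2−1)·(‖λM₁+M₀‖_F + ‖ΔL‖_F))`. -/
theorem statement_11 {𝕂 : Type*} [RCLike 𝕂] (m n ε η d : ℕ)
    (hm : 1 ≤ m) (hn : 1 ≤ n) (hε : 1 ≤ ε) (hη : 1 ≤ η) (hd : d = ε + η + 1)
    (M : Matrix (Fin (η + 1) × Fin m) (Fin (ε + 1) × Fin n) (Polynomial 𝕂))
    (hM : ∀ i j, (M i j).natDegree ≤ 1)
    (ΔL : Matrix ((Fin (η + 1) × Fin m) ⊕ (Fin ε × Fin n))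
      ((Fin (ε + 1) × Fin n) ⊕ (Fin η × Fin m)) (Polynomial 𝕂))
    (hΔLdeg : ∀ i j, (ΔL i j).natDegree ≤ 1)
    (hΔLsmall : polyFrob ΔL < ((Real.sqrt 2 - 1) / (d : ℝ)) ^ 2 * (1 / (1 + polyFrob M))) :
    ∃ (C : Matrix (Fin ε × Fin n) (Fin (η + 1) × Fin m) 𝕂)
      (D : Matrix (Fin (ε + 1) × Fin n) (Fin η × Fin m) 𝕂)
      (ΔL12 : Matrix (Fin (η + 1) × Fin m) (Fin η × Fin m) (Polynomial 𝕂))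
      (ΔL21 : Matrix (Fin ε × Fin n) (Fin (ε + 1) × Fin n) (Polynomial 𝕂)),
      (∀ i j, (ΔL12 i j).natDegree ≤ 1) ∧ (∀ i j, (ΔL21 i j).natDegree ≤ 1) ∧
      Real.sqrt (frobNorm C ^ 2 + frobNorm D ^ 2) ≤
        (d : ℝ) * polyFrob ΔL / (Real.sqrt 2 - 1) ∧
      Matrix.fromBlocks
          (1 : Matrix (Fin (η + 1) × Fin m) (Fin (η + 1) × Fin m) (Polynomial 𝕂)) 0
          (C.map Polynomial.C)
          (1 : Matrix (Fin ε × Fin n) (Fin ε × Fin n) (Polynomial 𝕂)) * (blockKron 𝕂 ε n η m M + ΔL) *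
          Matrix.fromBlocks
            (1 : Matrix (Fin (ε + 1) × Fin n) (Fin (ε + 1) × Fin n) (Polynomial 𝕂))
            (D.map Polynomial.C) 0
            (1 : Matrix (Fin η × Fin m) (Fin η × Fin m) (Polynomial 𝕂)) =
        Matrix.fromBlocks (M + ΔL.toBlocks₁₁)
          ((Lk 𝕂 η).transpose ⊗ₖ (1 : Matrix (Fin m) (Fin m) (Polynomial 𝕂)) + ΔL12)
          ((Lk 𝕂 ε) ⊗ₖ (1 : Matrix (Fin n) (Fin n) (Polynomial 𝕂)) + ΔL21) 0 ∧
      max (polyFrob ΔL21) (polyFrob ΔL12) ≤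
        polyFrob ΔL * (1 + ((d : ℝ) / (Real.sqrt 2 - 1)) * (polyFrob M + polyFrob ΔL)) := by
  have h2a : (1.414 : ℝ) < Real.sqrt 2 := by
    rw [Real.lt_sqrt (by norm_num)]; norm_num
  have hd3 : (3 : ℝ) ≤ d := by rw [hd]; exact_mod_cast (by omega : 3 ≤ ε + η + 1)
  have hεd : (ε : ℝ) + 1 ≤ d := by rw [hd]; exact_mod_cast (by omega : ε + 1 ≤ ε + η + 1)
  have hδ : 0 ≤ polyFrob ΔL := Real.sqrt_nonneg _
  have hμ : 0 ≤ polyFrob M := Real.sqrt_nonneg _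
  have hb := toY_blocks ΔL
  rw [← polyFrob_eq ΔL hΔLdeg] at hb
  have hMn := polyFrob_eq M hM
  have d11 : ∀ i j, (ΔL.toBlocks₁₁ i j).natDegree ≤ 1 := fun i j => hΔLdeg _ _
  have d12 : ∀ i j, (ΔL.toBlocks₁₂ i j).natDegree ≤ 1 := fun i j => hΔLdeg _ _
  have d21 : ∀ i j, (ΔL.toBlocks₂₁ i j).natDegree ≤ 1 := fun i j => hΔLdeg _ _
  have d22 : ∀ i j, (ΔL.toBlocks₂₂ i j).natDegree ≤ 1 := fun i j => hΔLdeg _ _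
  have n11 := norm_nonneg (toY ΔL.toBlocks₁₁)
  have n12 := norm_nonneg (toY ΔL.toBlocks₁₂)
  have n21 := norm_nonneg (toY ΔL.toBlocks₂₁)
  have n22 := norm_nonneg (toY ΔL.toBlocks₂₂)
  have l11 : ‖toY ΔL.toBlocks₁₁‖ ≤ polyFrob ΔL := sq_le_helper (by nlinarith) hδ
  have l12 : ‖toY ΔL.toBlocks₁₂‖ ≤ polyFrob ΔL := sq_le_helper (by nlinarith) hδ
  have l21 : ‖toY ΔL.toBlocks₂₁‖ ≤ polyFrob ΔL := sq_le_helper (by nlinarith) hδ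
  have l22 : ‖toY ΔL.toBlocks₂₂‖ ≤ polyFrob ΔL := sq_le_helper (by nlinarith) hδ
  have hN : ‖toY (M + ΔL.toBlocks₁₁)‖ ≤ polyFrob M + polyFrob ΔL := by
    rw [toY_add, hMn]
    exact (norm_add_le _ _).trans (by gcongr)
  obtain ⟨C, D, hCD, hE⟩ := main_exists m n ε η (d : ℝ) (Real.sqrt 2 - 1) (polyFrob ΔL)
    (polyFrob M) _ _ hd3 hεd rfl hδ hμ rfl rfl hΔLsmall (M + ΔL.toBlocks₁₁) ΔL.toBlocks₁₂
    ΔL.toBlocks₂₁ ΔL.toBlocks₂₂ hN (by nlinarith) l22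
  have hNd := deg_add _ _ hM d11
  have ha0 : 0 < Real.sqrt 2 - 1 := by linarith
  have hr0 : 0 ≤ (d : ℝ) * polyFrob ΔL / (Real.sqrt 2 - 1) := by positivity
  have hC : frobNorm C ≤ (d : ℝ) * polyFrob ΔL / (Real.sqrt 2 - 1) := by
    rw [frobNorm_eq]
    exact sq_le_helper (le_trans (le_add_of_nonneg_right (sq_nonneg _)) hCD) hr0
  have hD : frobNorm D ≤ (d : ℝ) * polyFrob ΔL / (Real.sqrt 2 - 1) := by
    rw [frobNorm_eq]
    exact sq_le_helper (le_trans (le_add_of_nonneg_left (sq_nonneg _)) hCD) hr0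
  have t12 := deg_add _ _ d12 (deg_mulc (M + ΔL.toBlocks₁₁) D hNd)
  have t21 := deg_add _ _ d21 (deg_cmul C (M + ΔL.toBlocks₁₁) hNd)
  have hE0 := eq_zero_of_toY _ ?_ hE
  · refine ⟨C, D, ΔL.toBlocks₁₂ + (M + ΔL.toBlocks₁₁) * D.map Polynomial.C,
      ΔL.toBlocks₂₁ + C.map Polynomial.C * (M + ΔL.toBlocks₁₁), t12, t21, ?_, ?_, ?_⟩
    · rw [frobNorm_eq, frobNorm_eq]
      exact Real.sqrt_le_iff.2 ⟨hr0, hCD⟩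
    · conv_lhs => rw [← Matrix.fromBlocks_toBlocks ΔL]
      rw [blockKron, Matrix.fromBlocks_add, Matrix.fromBlocks_multiply, Matrix.fromBlocks_multiply]
      rw [Matrix.fromBlocks_inj]
      simp only [Matrix.one_mul, Matrix.zero_mul, Matrix.mul_one, Matrix.mul_zero, add_zero,
        zero_add]
      refine ⟨trivial, ?_, ?_, ?_⟩
      · abel
      · abel
      · rw [← hE0]
        simp only [Matrix.add_mul, Matrix.mul_add]
        abel
    · rw [polyFrob_eq _ t12, polyFrob_eq _ t21, toY_add, toY_add]
      have hν0 : 0 ≤ polyFrob M + polyFrob ΔL := by positivity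
      have key : polyFrob ΔL * (1 + ((d : ℝ) / (Real.sqrt 2 - 1)) * (polyFrob M + polyFrob ΔL)) =
          polyFrob ΔL + ((d : ℝ) * polyFrob ΔL / (Real.sqrt 2 - 1)) *
            (polyFrob M + polyFrob ΔL) := by ring
      rw [key]
      rw [frobNorm_eq] at hC hD
      refine max_le ?_ ?_
      · refine (norm_add_le _ _).trans (add_le_add l21 ((toY_cmul _ _).trans ?_))
        exact mul_le_mul hC hN (norm_nonneg _) hr0
      · refine (norm_add_le _ _).trans (add_le_add l12 ((toY_mulc _ _).trans ?_))
        rw [mul_comm]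
        exact mul_le_mul hD hN (norm_nonneg _) hr0
  · have dη := deg_kron (l := m) (Lk 𝕂 η).transpose (fun i j => deg_Lk η j i)
    have dε := deg_kron (l := n) (Lk 𝕂 ε) (deg_Lk ε)
    exact deg_add _ _ (deg_add _ _ (deg_cmul C _ dη) (deg_mulc _ D dε))
      (deg_add _ _ (deg_add _ _ (deg_add _ _ d22 (deg_cmul C _ d12)) (deg_mulc _ D d21))
        (deg_mulc _ D (deg_cmul C _ hNd)))

end main
end

section
/- Let F be a field and n ≥ 1, ε ≥ 1 integers, and regard L_ε(λ)⊗I_n as a matrix polynomial of grade 1 of size εn×(ε+1)n. Then the square matrix C_{ε−1}(L_ε(λ)⊗I_n) ∈ F^{ε(ε+1)n × ε(ε+1)n} is invertible, and the matrix C_ε(L_ε(λ)⊗I_n) ∈ F^{ε(ε+2)n × (ε+1)²n} has full row rank ε(ε+2)n. -/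
open Polynomial Matrix
open scoped Kronecker

/-- The convolution matrix `C_j(Q)` of a matrix polynomial `Q(λ) = Σ_{i=0}^q Q_i λ^i` of
grade `q`: the constant `(q+j+1)m × (j+1)n` block matrix whose `(r,c)` block (for
`r = 0,…,q+j`, `c = 0,…,j`) equals `Q_{q−(r−c)}` if `0 ≤ r−c ≤ q` and `0` otherwise. -/
noncomputable def convMat {R : Type*} [CommRing R] {ι κ : Type*} (q j : ℕ)
    (Q : Matrix ι κ (Polynomial R)) :
    Matrix (Fin (q + j + 1) × ι) (Fin (j + 1) × κ) R :=
  Matrix.of fun ri cj =>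
    if (cj.1 : ℕ) ≤ (ri.1 : ℕ) ∧ (ri.1 : ℕ) ≤ (cj.1 : ℕ) + q
    then (Q ri.2 cj.2).coeff (q + (cj.1 : ℕ) - (ri.1 : ℕ)) else 0

theorem entry_aux (F : Type*) [Field F] (n ε j : ℕ)
    (r : Fin (1 + j + 1)) (i : Fin ε) (a : Fin n) (c : Fin (j + 1)) (l : Fin (ε + 1)) (b : Fin n) :
    convMat 1 j ((Lk F ε) ⊗ₖ (1 : Matrix (Fin n) (Fin n) (Polynomial F))) (r, (i, a)) (c, (l, b))
      = (if (r : ℕ) = c ∧ (l : ℕ) = i + 1 ∧ a = b then 1 else 0)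
        - (if (r : ℕ) = c + 1 ∧ (l : ℕ) = i ∧ a = b then 1 else 0) := by
  simp only [convMat, Lk, Matrix.of_apply, Matrix.kroneckerMap_apply, Matrix.one_apply]
  by_cases hab : a = b
  swap
  · simp [hab]
  by_cases h1 : (r : ℕ) = c
  · have e : 1 + (c : ℕ) - r = 1 := by omega
    by_cases h2 : (l : ℕ) = i
    · have h3 : ¬ ((l : ℕ) = i + 1) := by omega
      simp [hab, h1, h2, Polynomial.coeff_one]
    · by_cases h3 : (l : ℕ) = i + 1
      · simp [hab, h1, h3]
      · simp [hab, h1, h2, h3]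
  · by_cases h4 : (r : ℕ) = c + 1
    · by_cases h2 : (l : ℕ) = i
      · simp [hab, h2, h4, show 1 + (c : ℕ) - (c + 1) = 0 by omega]
      · by_cases h3 : (l : ℕ) = i + 1
        · simp [hab, h3, h4, show 1 + (c : ℕ) - (c + 1) = 0 by omega]
        · simp [hab, h2, h3, h4]
    · have h5 : ¬ ((c : ℕ) ≤ r ∧ (r : ℕ) ≤ c + 1) := by omega
      simp [h1, h4, h5]

theorem vecMul_aux (F : Type*) [Field F] (n ε j : ℕ) (hj : ε ≤ j + 1)
    (y : Fin (1 + j + 1) × (Fin ε × Fin n) → F)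
    (hy : y ᵥ* convMat 1 j ((Lk F ε) ⊗ₖ (1 : Matrix (Fin n) (Fin n) (Polynomial F))) = 0) :
    y = 0 := by
  -- extension by zero
  let g : ℕ → ℕ → Fin n → F := fun r i b =>
    if h : r < 1 + j + 1 ∧ i < ε then y (⟨r, h.1⟩, (⟨i, h.2⟩, b)) else 0
  have hS : ∀ (r i : ℕ) (b : Fin n),
      ∑ x : Fin (1 + j + 1) × (Fin ε × Fin n),
        y x * (if (x.1 : ℕ) = r ∧ i = x.2.1 ∧ x.2.2 = b then 1 else 0) = g r i b := by
    intro r i b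
    by_cases h : r < 1 + j + 1 ∧ i < ε
    · rw [Finset.sum_eq_single (⟨r, h.1⟩, (⟨i, h.2⟩, b))]
      · simp only [g]
        rw [dif_pos h]
        simp
      · rintro ⟨x, i', b'⟩ _ hne
        rw [if_neg, mul_zero]
        rintro ⟨h1, h2, h3⟩
        apply hne
        simp only [Prod.mk.injEq, Fin.ext_iff] at *
        exact ⟨h1, h2.symm, h3⟩
      · simp
    · simp only [g, dif_neg h]
      apply Finset.sum_eq_zero
      rintro ⟨x, i', b'⟩ _
      rw [if_neg, mul_zero]
      rintro ⟨h1, h2, h3⟩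
      apply h
      have := x.2
      have := i'.2
      simp only at h1 h2
      omega
  have key : ∀ (c l : ℕ) (b : Fin n), c < j + 1 → l < ε + 1 →
      (if l = 0 then 0 else g c (l - 1) b) = g (c + 1) l b := by
    intro c l b hc hl
    have h := congrFun hy (⟨c, hc⟩, (⟨l, hl⟩, b))
    simp only [Matrix.vecMul, dotProduct, Pi.zero_apply] at h
    have hE : ∀ x : Fin (1 + j + 1) × (Fin ε × Fin n),
        y x * convMat 1 j ((Lk F ε) ⊗ₖ (1 : Matrix (Fin n) (Fin n) (Polynomial F))) x
          (⟨c, hc⟩, (⟨l, hl⟩, b))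
        = y x * (if (x.1 : ℕ) = c ∧ l = (x.2.1 : ℕ) + 1 ∧ x.2.2 = b then 1 else 0)
          - y x * (if (x.1 : ℕ) = c + 1 ∧ l = (x.2.1 : ℕ) ∧ x.2.2 = b then 1 else 0) := by
      rintro ⟨r, i, a⟩
      rw [entry_aux, mul_sub]
    simp only [hE] at h
    rw [Finset.sum_sub_distrib] at h
    have h2 := hS (c + 1) l b
    rw [sub_eq_zero] at h
    rw [← h2]
    refine Eq.trans ?_ h
    split_ifs with h0
    · symm
      apply Finset.sum_eq_zero
      intro x _
      rw [if_neg, mul_zero]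
      rintro ⟨_, h3, _⟩
      omega
    · rw [← hS]
      apply Finset.sum_congr rfl
      intro x _
      have : l - 1 = (x.2.1 : ℕ) ↔ l = (x.2.1 : ℕ) + 1 := by omega
      simp only [this]
  have hdown : ∀ (i r : ℕ) (b : Fin n), i < r → r < 1 + j + 1 → i < ε → g r i b = 0 := by
    intro i
    induction i with
    | zero =>
      intro r b h1 h2 h3
      have := key (r - 1) 0 b (by omega) (by omega)
      rw [show r - 1 + 1 = r by omega] at this
      simpa using this.symm
    | succ i ih =>
      intro r b h1 h2 h3
      have := key (r - 1) (i + 1) b (by omega) (by omega)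
      rw [show r - 1 + 1 = r by omega] at this
      rw [← this]
      simpa using ih (r - 1) b (by omega) (by omega) (by omega)
  have hup : ∀ (k i r : ℕ) (b : Fin n), i + k = ε → r ≤ i → g r i b = 0 := by
    intro k
    induction k with
    | zero =>
      intro i r b h1 h2
      exact dif_neg (by omega)
    | succ k ih =>
      intro i r b h1 h2
      have := key r (i + 1) b (by omega) (by omega)
      rw [ih (i + 1) (r + 1) b (by omega) (by omega)] at this
      simpa using this
  funext ⟨r, i, b⟩
  have hg : g r i b = y (r, (i, b)) := by
    simp only [g]
    rw [dif_pos ⟨r.2, i.2⟩]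
  rw [← hg]
  rcases lt_or_ge (i : ℕ) (r : ℕ) with h | h
  · exact hdown _ _ _ h r.2 i.2
  · exact hup (ε - i) _ _ _ (by omega) h

theorem inj_aux (F : Type*) [Field F] (n ε j : ℕ) (hj : ε ≤ j + 1) :
    Function.Injective
      (convMat 1 j ((Lk F ε) ⊗ₖ (1 : Matrix (Fin n) (Fin n) (Polynomial F)))).vecMulLinear := by
  rw [injective_iff_map_eq_zero]
  intro y hy
  exact vecMul_aux F n ε j hj y hy

/-- For the grade-1 matrix polynomial `L_ε(λ)⊗I_n`, the square convolution
matrix `C_{ε−1}(L_ε(λ)⊗I_n)` is invertible (has a two-sided inverse) and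
`C_ε(L_ε(λ)⊗I_n)` has full row rank `ε(ε+2)n`. -/
theorem statement_13 (F : Type*) [Field F] (n ε : ℕ) (hn : 1 ≤ n) (hε : 1 ≤ ε) :
    (∃ B : Matrix (Fin (ε - 1 + 1) × (Fin (ε + 1) × Fin n))
        (Fin (1 + (ε - 1) + 1) × (Fin ε × Fin n)) F,
      convMat 1 (ε - 1) ((Lk F ε) ⊗ₖ (1 : Matrix (Fin n) (Fin n) (Polynomial F))) * B = 1 ∧
      B * convMat 1 (ε - 1) ((Lk F ε) ⊗ₖ (1 : Matrix (Fin n) (Fin n) (Polynomial F))) = 1) ∧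
    (convMat 1 ε ((Lk F ε) ⊗ₖ (1 : Matrix (Fin n) (Fin n) (Polynomial F)))).rank
      = ε * (ε + 2) * n := by
  constructor
  · have hinj := inj_aux F n ε (ε - 1) (by omega)
    have hcard : Fintype.card (Fin (1 + (ε - 1) + 1) × (Fin ε × Fin n))
        = Fintype.card (Fin (ε - 1 + 1) × (Fin (ε + 1) × Fin n)) := by
      simp only [Fintype.card_prod, Fintype.card_fin]
      rw [show 1 + (ε - 1) + 1 = ε + 1 by omega, show ε - 1 + 1 = ε by omega]
      ring
    have hsurj := (LinearMap.injective_iff_surjective_of_finrank_eq_finrank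
      (by simpa only [Module.finrank_fintype_fun_eq_card] using hcard)).1 hinj
    obtain ⟨B, hB⟩ := Matrix.vecMul_surjective_iff_exists_left_inverse.1 hsurj
    exact ⟨B, (Matrix.mul_eq_one_comm_of_card_eq _ _ _ hcard.symm).1 hB, hB⟩
  · have hinj := inj_aux F n ε ε (by omega)
    have := (Matrix.vecMul_injective_iff.1 hinj).rank_matrix
    rw [this]
    simp only [Fintype.card_prod, Fintype.card_fin]
    ring
end

section
/- Let 𝕂 be ℝ or ℂ, n ≥ 1, ε ≥ 1, and let ΔL_{21}(λ) be any pencil of size εn×(ε+1)n over 𝕂 with ‖ΔL_{21}(λ)‖_F < 3/(2(ε+1)^{3/2}). Then the square matrix C_{ε−1}(L_ε(λ)⊗I_n + ΔL_{21}(λ)) is invertible and the matrix C_ε(L_ε(λ)⊗I_n + ΔL_{21}(λ)) has full row rank ε(ε+2)n. (These two rank conditions express precisely, via the paper's convolution-matrix characterization, that L_ε(λ)⊗I_n + ΔL_{21}(λ) is a minimal basis with all row degrees equal to 1 whose dual minimal bases have all row degrees equal to ε.) -/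
open Polynomial Matrix
open scoped Kronecker

lemma aux_sq {E : Type*} [SeminormedAddCommGroup E] (a b : E) (c : ℝ) (hc : 0 < c) :
    ‖a + b‖ ^ 2 ≤ (c + 1) * ‖b‖ ^ 2 + (c + 1) / c * ‖a‖ ^ 2 := by
  have h := norm_add_le a b
  have h2 : ‖a + b‖ ^ 2 ≤ (‖a‖ + ‖b‖) ^ 2 := by gcongr
  refine h2.trans ?_
  have : (c + 1) * ‖b‖ ^ 2 + (c + 1) / c * ‖a‖ ^ 2 - (‖a‖ + ‖b‖) ^ 2 = (c * ‖b‖ - ‖a‖) ^ 2 / c := by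
    field_simp
    ring
  have : 0 ≤ (c * ‖b‖ - ‖a‖) ^ 2 / c := by positivity
  linarith

lemma chain_up {𝕂 : Type*} [RCLike 𝕂] (N : ℕ) (X G : ℕ → ℕ → 𝕂)
    (h0 : ∀ i < N, X 0 (i + 1) = G 0 i)
    (hs : ∀ c, c < N → ∀ i < N, X (c + 1) (i + 1) = X c i + G (c + 1) i) (c : ℕ) (hc : c < N) :
    ∑ i ∈ Finset.Ico c N, ‖X c (i + 1)‖ ^ 2 ≤
      ((c : ℝ) + 1) * ∑ r ∈ Finset.range (c + 1), ∑ i ∈ Finset.Ico r N, ‖G r i‖ ^ 2 := by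
  induction c with
  | zero =>
    simp only [Nat.cast_zero, zero_add, one_mul, Finset.sum_range_one]
    refine le_of_eq (Finset.sum_congr rfl fun i hi => ?_)
    rw [h0 i (Finset.mem_Ico.1 hi).2]
  | succ c ih =>
    have ih := ih (by omega)
    have e : ∑ i ∈ Finset.Ico (c + 1) N, ‖X c i‖ ^ 2 ≤ ∑ i ∈ Finset.Ico c N, ‖X c (i + 1)‖ ^ 2 := by
      rw [Finset.sum_Ico_add' (fun i => ‖X c i‖ ^ 2) c N 1]
      exact Finset.sum_le_sum_of_subset_of_nonneg
        (Finset.Ico_subset_Ico le_rfl (by omega)) (fun _ _ _ => by positivity)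
    rw [Finset.sum_range_succ _ (c + 1)]
    have hcp : (0 : ℝ) < (c : ℝ) + 1 := by positivity
    have k : ∑ i ∈ Finset.Ico (c + 1) N, ‖X (c + 1) (i + 1)‖ ^ 2 ≤
        ((c : ℝ) + 1 + 1) * ∑ i ∈ Finset.Ico (c + 1) N, ‖G (c + 1) i‖ ^ 2 +
        ((c : ℝ) + 1 + 1) / (c + 1) * ∑ i ∈ Finset.Ico (c + 1) N, ‖X c i‖ ^ 2 := by
      rw [Finset.mul_sum, Finset.mul_sum, ← Finset.sum_add_distrib]
      refine Finset.sum_le_sum fun i hi => ?_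
      rw [hs c (by omega) i (Finset.mem_Ico.1 hi).2]
      exact aux_sq _ _ _ hcp
    refine k.trans ?_
    have := mul_le_mul_of_nonneg_left (e.trans ih)
      (show (0 : ℝ) ≤ ((c : ℝ) + 1 + 1) / (c + 1) by positivity)
    rw [← mul_assoc, div_mul_cancel₀ _ hcp.ne'] at this
    push_cast
    linarith

lemma chain_down {𝕂 : Type*} [RCLike 𝕂] (N : ℕ) (X G : ℕ → ℕ → 𝕂)
    (hN : ∀ i, X N i = 0)
    (hs : ∀ c, c < N → ∀ i < N, X (c + 1) (i + 1) = X c i + G (c + 1) i) (t : ℕ) (ht : t ≤ N) :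
    ∑ i ∈ Finset.range (N - t + 1), ‖X (N - t) i‖ ^ 2 ≤
      (t : ℝ) * ∑ r ∈ Finset.Ioc (N - t) N, ∑ i ∈ Finset.range r, ‖G r i‖ ^ 2 := by
  induction t with
  | zero => simp [hN]
  | succ t ih =>
    have ih := ih (by omega)
    obtain ⟨c, hc⟩ : ∃ c, c = N - (t + 1) := ⟨_, rfl⟩
    have hc' : N - t = c + 1 := by omega
    rw [← hc]
    rw [hc'] at ih
    have e : ∑ i ∈ Finset.range (c + 1), ‖X (c + 1) (i + 1)‖ ^ 2 ≤
        ∑ i ∈ Finset.range (c + 1 + 1), ‖X (c + 1) i‖ ^ 2 := by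
      rw [Finset.sum_range_succ' _ (c + 1)]
      have : 0 ≤ ‖X (c + 1) 0‖ ^ 2 := by positivity
      linarith
    have hI : Finset.Ioc c N = insert (c + 1) (Finset.Ioc (c + 1) N) := by
      ext; simp; omega
    rw [hI, Finset.sum_insert (by simp)]
    rcases Nat.eq_zero_or_pos t with h0 | h0
    · subst h0
      have hcN : c + 1 = N := by omega
      simp only [Nat.zero_add, Nat.cast_one, one_mul]
      have : ∑ i ∈ Finset.range (c + 1), ‖X c i‖ ^ 2 =
          ∑ i ∈ Finset.range (c + 1), ‖G (c + 1) i‖ ^ 2 := by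
        refine Finset.sum_congr rfl fun i hi => ?_
        have h := hs c (by omega) i (by have := Finset.mem_range.1 hi; omega)
        rw [hcN, hN] at h
        rw [hcN, ← norm_neg, eq_comm]
        congr 2
        linear_combination -h
      rw [this, hcN]
      simp
    have hcp : (0 : ℝ) < (t : ℝ) := by positivity
    have k : ∑ i ∈ Finset.range (c + 1), ‖X c i‖ ^ 2 ≤
        ((t : ℝ) + 1) * ∑ i ∈ Finset.range (c + 1), ‖G (c + 1) i‖ ^ 2 +
        ((t : ℝ) + 1) / t * ∑ i ∈ Finset.range (c + 1), ‖X (c + 1) (i + 1)‖ ^ 2 := by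
      rw [Finset.mul_sum, Finset.mul_sum, ← Finset.sum_add_distrib]
      refine Finset.sum_le_sum fun i hi => ?_
      have h := hs c (by omega) i (by have := Finset.mem_range.1 hi; omega)
      have h' : X c i = X (c + 1) (i + 1) + -G (c + 1) i := by rw [h]; ring
      rw [h', ← norm_neg (G (c + 1) i)]
      exact aux_sq _ _ _ hcp
    refine k.trans ?_
    have := mul_le_mul_of_nonneg_left (e.trans ih)
      (show (0 : ℝ) ≤ ((t : ℝ) + 1) / t by positivity)
    rw [← mul_assoc, div_mul_cancel₀ _ hcp.ne'] at this
    push_cast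
    linarith

lemma chain_total {𝕂 : Type*} [RCLike 𝕂] (N : ℕ) (X G : ℕ → ℕ → 𝕂)
    (hN : ∀ i, X N i = 0)
    (h0 : ∀ i < N, X 0 (i + 1) = G 0 i)
    (hs : ∀ c, c < N → ∀ i < N, X (c + 1) (i + 1) = X c i + G (c + 1) i) :
    ∑ c ∈ Finset.range N, ∑ k ∈ Finset.range (N + 1), ‖X c k‖ ^ 2 ≤
      (N : ℝ) ^ 2 * ∑ r ∈ Finset.range (N + 1), ∑ i ∈ Finset.range N, ‖G r i‖ ^ 2 := by
  have key : ∀ c ∈ Finset.range N, ∑ k ∈ Finset.range (N + 1), ‖X c k‖ ^ 2 ≤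
      N * ∑ r ∈ Finset.range (N + 1), ∑ i ∈ Finset.range N, ‖G r i‖ ^ 2 := by
    intro c hc
    have hc := Finset.mem_range.1 hc
    have hu := chain_up N X G h0 hs c hc
    have hd := chain_down N X G hN hs (N - c) (by omega)
    rw [Nat.sub_sub_self hc.le] at hd
    rw [← Finset.sum_range_add_sum_Ico _ (show c + 1 ≤ N + 1 by omega),
      ← Finset.sum_Ico_add' (fun i => ‖X c i‖ ^ 2) c N 1]
    have e : ∑ r ∈ Finset.range (N + 1), ∑ i ∈ Finset.range N, ‖G r i‖ ^ 2 =
        ∑ r ∈ Finset.range (N + 1), ∑ i ∈ Finset.range r, ‖G r i‖ ^ 2 +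
        ∑ r ∈ Finset.range (N + 1), ∑ i ∈ Finset.Ico r N, ‖G r i‖ ^ 2 := by
      rw [← Finset.sum_add_distrib]
      refine Finset.sum_congr rfl fun r hr => ?_
      rw [Finset.sum_range_add_sum_Ico _ (by have := Finset.mem_range.1 hr; omega)]
    rw [e, mul_add]
    refine add_le_add (hd.trans ?_) (hu.trans ?_)
    · refine mul_le_mul (by exact_mod_cast Nat.sub_le _ _) ?_ (by positivity) (by positivity)
      refine Finset.sum_le_sum_of_subset_of_nonneg ?_ (fun _ _ _ => by positivity)
      intro r; simp <;> omega
    · refine mul_le_mul (by exact_mod_cast hc) ?_ (by positivity) (by positivity)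
      refine Finset.sum_le_sum_of_subset_of_nonneg ?_ (fun _ _ _ => by positivity)
      intro r; simp <;> omega
  refine (Finset.sum_le_sum key).trans (le_of_eq ?_)
  simp; ring

/-- Zero extension in the first index. -/
noncomputable def extX {𝕂 κ : Type*} [RCLike 𝕂] {m : ℕ} (x : Fin (m + 1) × κ → 𝕂)
    (c : ℕ) (q : κ) : 𝕂 :=
  if h : c < m + 1 then x (⟨c, h⟩, q) else 0

/-- Shifted zero extension. -/
noncomputable def extS {𝕂 κ : Type*} [RCLike 𝕂] {m : ℕ} (x : Fin (m + 1) × κ → 𝕂) :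
    ℕ → κ → 𝕂
  | 0, _ => 0
  | c + 1, q => extX x c q

lemma conv_mulVec {𝕂 ι κ : Type*} [RCLike 𝕂] [Fintype κ] (m : ℕ)
    (Q : Matrix ι κ (Polynomial 𝕂)) (x : Fin (m + 1) × κ → 𝕂) (r : Fin (1 + m + 1)) (p : ι) :
    (convMat 1 m Q *ᵥ x) (r, p) =
      ∑ q, ((Q p q).coeff 1 * extX x r q + (Q p q).coeff 0 * extS x r q) := by
  rw [Matrix.mulVec, dotProduct, Fintype.sum_prod_type, Finset.sum_comm]
  refine Finset.sum_congr rfl fun q _ => ?_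
  rw [Finset.sum_fin_eq_sum_range]
  obtain ⟨r, hr⟩ := r
  have : ∀ c ∈ Finset.range (m + 1), (if h : c < m + 1 then
      convMat 1 m Q (⟨r, hr⟩, p) (⟨c, h⟩, q) * x (⟨c, h⟩, q) else 0) =
      (if r = c then (Q p q).coeff 1 * extX x c q else 0) +
      (if r = c + 1 then (Q p q).coeff 0 * extX x c q else 0) := by
    intro c hc
    have hc := Finset.mem_range.1 hc
    simp only [hc, dif_pos, convMat, Matrix.of_apply, extX]
    by_cases h1 : r = c
    · subst h1; simp
    · by_cases h2 : r = c + 1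
      · subst h2
        have : 1 + c - (c + 1) = 0 := by omega
        simp [this]
      · rw [if_neg (by omega)]; simp [h1, h2]
  rw [Finset.sum_congr rfl this, Finset.sum_add_distrib]
  congr 1
  · rw [Finset.sum_ite_eq]
    split_ifs with h
    · rfl
    · rw [Finset.mem_range] at h
      simp [extX, h]
  · cases r with
    | zero => simp [extS]
    | succ r =>
      simp only [add_left_inj, extS]
      rw [Finset.sum_ite_eq, if_pos]
      rw [Finset.mem_range]; omega

lemma sum_extX {𝕂 κ : Type*} [RCLike 𝕂] [Fintype κ] {m : ℕ} (x : Fin (m + 1) × κ → 𝕂) :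
    ∑ c ∈ Finset.range (m + 1), ∑ q, ‖extX x c q‖ ^ 2 = ∑ s, ‖x s‖ ^ 2 := by
  rw [Fintype.sum_prod_type, Finset.sum_range]
  refine Finset.sum_congr rfl fun c _ => Finset.sum_congr rfl fun q _ => ?_
  simp only [extX, c.2, dif_pos]

lemma conv_bound {𝕂 ι κ : Type*} [RCLike 𝕂] [Fintype ι] [Fintype κ] (m : ℕ)
    (Q : Matrix ι κ (Polynomial 𝕂)) (x : Fin (m + 1) × κ → 𝕂) :
    ∑ s, ‖(convMat 1 m Q *ᵥ x) s‖ ^ 2 ≤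
      2 * (∑ p, ∑ q, (‖(Q p q).coeff 0‖ ^ 2 + ‖(Q p q).coeff 1‖ ^ 2)) * ∑ s, ‖x s‖ ^ 2 := by
  have key : ∀ (r : Fin (1 + m + 1)) p, ‖(convMat 1 m Q *ᵥ x) (r, p)‖ ^ 2 ≤
      (∑ q, (‖(Q p q).coeff 0‖ ^ 2 + ‖(Q p q).coeff 1‖ ^ 2)) *
      (∑ q, ‖extX x r q‖ ^ 2 + ∑ q, ‖extS x r q‖ ^ 2) := by
    intro r p
    rw [conv_mulVec, Finset.sum_add_distrib]
    have h1 : ‖∑ q, (Q p q).coeff 1 * extX x r q + ∑ q, (Q p q).coeff 0 * extS x r q‖ ≤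
        ∑ s : κ ⊕ κ, Sum.elim (fun q => ‖(Q p q).coeff 1‖) (fun q => ‖(Q p q).coeff 0‖) s *
          Sum.elim (fun q => ‖extX x r q‖) (fun q => ‖extS x r q‖) s := by
      rw [Fintype.sum_sum_type]
      refine (norm_add_le _ _).trans (add_le_add ?_ ?_)
      · refine (norm_sum_le _ _).trans (le_of_eq ?_)
        simp
      · refine (norm_sum_le _ _).trans (le_of_eq ?_)
        simp
    have h2 := pow_le_pow_left₀ (norm_nonneg _) h1 2
    refine h2.trans ((Finset.sum_mul_sq_le_sq_mul_sq _ _ _).trans (le_of_eq ?_))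
    simp only [Fintype.sum_sum_type, Sum.elim_inl, Sum.elim_inr, Finset.sum_add_distrib]
    ring
  rw [Fintype.sum_prod_type]
  refine (Finset.sum_le_sum fun r _ => Finset.sum_le_sum fun p _ => key r p).trans
    (le_of_eq ?_)
  simp_rw [← Finset.sum_mul]
  rw [← Finset.mul_sum, Finset.sum_add_distrib]
  have e1 : ∑ r : Fin (1 + m + 1), ∑ q, ‖extX x r q‖ ^ 2 = ∑ s, ‖x s‖ ^ 2 := by
    rw [← sum_extX, ← Finset.sum_range (fun r => ∑ q, ‖extX x r q‖ ^ 2), Finset.sum_range_succ,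
      add_comm 1 m]
    simp [extX]
  have e2 : ∑ r : Fin (1 + m + 1), ∑ q, ‖extS x r q‖ ^ 2 = ∑ s, ‖x s‖ ^ 2 := by
    rw [← sum_extX, ← Finset.sum_range (fun r => ∑ q, ‖extS x r q‖ ^ 2), Finset.sum_range_succ',
      add_comm 1 m]
    simp [extS]
  rw [e1, e2]; ring

lemma polyFrob_sq {𝕂 ι κ : Type*} [RCLike 𝕂] [Fintype ι] [Fintype κ]
    (Q : Matrix ι κ (Polynomial 𝕂)) (h : ∀ i j, (Q i j).natDegree ≤ 1) :
    polyFrob Q ^ 2 = ∑ p, ∑ q, (‖(Q p q).coeff 0‖ ^ 2 + ‖(Q p q).coeff 1‖ ^ 2) := by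
  rw [polyFrob, Real.sq_sqrt (by positivity)]
  refine Finset.sum_congr rfl fun p _ => Finset.sum_congr rfl fun q _ => ?_
  rw [Finset.sum_subset (s₂ := Finset.range 2)]
  · simp [Finset.sum_range_succ]
  · intro k hk
    have := Polynomial.le_natDegree_of_mem_supp k hk
    have := h p q
    rw [Finset.mem_range]; omega
  · intro k _ hk
    simp [Polynomial.notMem_support_iff.1 hk]

lemma convL {𝕂 : Type*} [RCLike 𝕂] (n m : ℕ)
    (x : Fin (m + 1) × (Fin (m + 1 + 1) × Fin n) → 𝕂) (r : Fin (1 + m + 1)) (i : Fin (m + 1))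
    (a : Fin n) :
    (convMat 1 m ((Lk 𝕂 (m + 1)) ⊗ₖ (1 : Matrix (Fin n) (Fin n) (Polynomial 𝕂))) *ᵥ x)
      (r, (i, a)) = extX x r (i.succ, a) - extS x r (i.castSucc, a) := by
  rw [conv_mulVec, Finset.sum_add_distrib, sub_eq_add_neg]
  congr 1
  · rw [Finset.sum_eq_single (i.succ, a)]
    · simp [Lk]
    · rintro ⟨k, b⟩ _ hk
      by_cases hb : a = b
      · subst hb
        have : (k : ℕ) ≠ i + 1 := by
          intro h; apply hk; simp [Fin.ext_iff, h]
        simp only [Matrix.kroneckerMap_apply, Lk, Matrix.of_apply, Matrix.one_apply_eq, mul_one,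
          if_neg this]
        split_ifs <;> simp [Polynomial.coeff_one]
      · simp [Matrix.one_apply_ne hb]
    · simp
  · rw [Finset.sum_eq_single (i.castSucc, a)]
    · simp [Lk]
    · rintro ⟨k, b⟩ _ hk
      by_cases hb : a = b
      · subst hb
        have : (k : ℕ) ≠ i := by
          intro h; apply hk; simp [Fin.ext_iff, h]
        simp only [Matrix.kroneckerMap_apply, Lk, Matrix.of_apply, Matrix.one_apply_eq, mul_one,
          if_neg this]
        split_ifs <;> simp
      · simp [Matrix.one_apply_ne hb]
    · simp

lemma convL_bound {𝕂 : Type*} [RCLike 𝕂] (n m : ℕ)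
    (x : Fin (m + 1) × (Fin (m + 1 + 1) × Fin n) → 𝕂) :
    ∑ s, ‖x s‖ ^ 2 ≤ ((m : ℝ) + 1) ^ 2 * ∑ s,
    ‖(convMat 1 m ((Lk 𝕂 (m + 1)) ⊗ₖ (1 : Matrix (Fin n) (Fin n) (Polynomial 𝕂))) *ᵥ x) s‖ ^ 2 := by
  have key : ∀ a : Fin n, ∑ c : Fin (m + 1), ∑ k : Fin (m + 1 + 1), ‖x (c, (k, a))‖ ^ 2 ≤
      ((m : ℝ) + 1) ^ 2 * ∑ r : Fin (1 + m + 1), ∑ i : Fin (m + 1),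
      ‖extX x r (i.succ, a) - extS x r (i.castSucc, a)‖ ^ 2 := by
    intro a
    let X : ℕ → ℕ → 𝕂 := fun c k => if h : k < m + 1 + 1 then extX x c (⟨k, h⟩, a) else 0
    let G : ℕ → ℕ → 𝕂 := fun r i => if h : i < m + 1 then
      extX x r (⟨i + 1, by omega⟩, a) - extS x r (⟨i, by omega⟩, a) else 0
    have := chain_total (m + 1) X G (by intro i; simp [X, extX])
      (by intro i hi; simp [X, G, hi, extS])
      (by intro c hc i hi
          have h1 : i < m + 1 + 1 := by omega
          have h2 : i + 1 < m + 1 + 1 := by omega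
          simp only [X, G, hi, extS, h1, h2, dif_pos]
          ring)
    rw [Finset.sum_range, Finset.sum_range] at this
    simp_rw [Finset.sum_range] at this
    rw [add_comm 1 m]
    convert this using 1
    · refine Finset.sum_congr rfl fun c _ => Finset.sum_congr rfl fun k _ => ?_
      simp only [X, extX, c.2, k.2, dif_pos]
    · push_cast
      congr 1
      refine Finset.sum_congr rfl fun c _ => Finset.sum_congr rfl fun k _ => ?_
      simp only [G, k.2, dif_pos]
      rfl
  have h := Finset.sum_le_sum fun a (_ : a ∈ Finset.univ) => key a
  rw [← Finset.mul_sum] at h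
  simp only [Fintype.sum_prod_type, convL]
  have e1 : ∑ c, ∑ k, ∑ a, ‖x (c, (k, a))‖ ^ 2 = ∑ a, ∑ c, ∑ k, ‖x (c, (k, a))‖ ^ 2 := by
    rw [Finset.sum_comm (γ := Fin n)]
    refine Finset.sum_congr rfl fun c _ => ?_
    rw [Finset.sum_comm]
  have e2 : ∑ r : Fin (1 + m + 1), ∑ i : Fin (m + 1), ∑ a,
      ‖extX x r (i.succ, a) - extS x r (i.castSucc, a)‖ ^ 2 =
      ∑ a, ∑ r : Fin (1 + m + 1), ∑ i : Fin (m + 1),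
      ‖extX x r (i.succ, a) - extS x r (i.castSucc, a)‖ ^ 2 := by
    rw [Finset.sum_comm (γ := Fin n)]
    refine Finset.sum_congr rfl fun c _ => ?_
    rw [Finset.sum_comm]
  rw [e1, e2]
  exact h

lemma convMat_add {R ι κ : Type*} [CommRing R] (q j : ℕ) (P Q : Matrix ι κ (Polynomial R)) :
    convMat q j (P + Q) = convMat q j P + convMat q j Q := by
  ext a b
  simp only [convMat, Matrix.of_apply, Matrix.add_apply, Polynomial.coeff_add]
  split_ifs <;> simp

lemma conv_inj {𝕂 : Type*} [RCLike 𝕂] (n m : ℕ)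
    (D : Matrix (Fin (m + 1) × Fin n) (Fin (m + 1 + 1) × Fin n) (Polynomial 𝕂))
    (hdeg : ∀ i j, (D i j).natDegree ≤ 1)
    (hsmall : polyFrob D < 3 / (2 * (((m + 1 : ℕ) : ℝ) + 1) ^ ((3 : ℝ) / 2)))
    (x : Fin (m + 1) × (Fin (m + 1 + 1) × Fin n) → 𝕂)
    (hx : convMat 1 m ((Lk 𝕂 (m + 1)) ⊗ₖ (1 : Matrix (Fin n) (Fin n) (Polynomial 𝕂)) + D) *ᵥ x
      = 0) : x = 0 := by
  rw [convMat_add, Matrix.add_mulVec] at hx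
  have h1 := convL_bound n m x
  rw [eq_neg_of_add_eq_zero_left hx] at h1
  simp only [Pi.neg_apply, norm_neg] at h1
  have h2 := conv_bound m D x
  rw [← polyFrob_sq D hdeg] at h2
  have hp : (0 : ℝ) ≤ polyFrob D := Real.sqrt_nonneg _
  have h3 := pow_lt_pow_left₀ hsmall hp two_ne_zero
  push_cast at h3
  have hm : (0 : ℝ) ≤ m := Nat.cast_nonneg m
  have h4 : (((m : ℝ) + 1 + 1) ^ ((3 : ℝ) / 2)) ^ 2 = ((m : ℝ) + 1 + 1) ^ 3 := by
    rw [← Real.rpow_natCast, ← Real.rpow_mul (by positivity), ← Real.rpow_natCast]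
    norm_num
  rw [div_pow, mul_pow, h4, lt_div_iff₀ (by positivity)] at h3
  set S := ∑ s, ‖x s‖ ^ 2 with hS
  have hS0 : 0 ≤ S := by positivity
  have h5 : S ≤ ((m : ℝ) + 1) ^ 2 * (2 * polyFrob D ^ 2 * S) :=
    h1.trans (mul_le_mul_of_nonneg_left h2 (by positivity))
  have h6 : S = 0 := by
    by_contra hne
    have hpos : 0 < S := lt_of_le_of_ne hS0 (Ne.symm hne)
    have h7 : 1 ≤ ((m : ℝ) + 1) ^ 2 * (2 * polyFrob D ^ 2) := by
      by_contra hlt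
      push Not at hlt
      have := mul_lt_mul_of_pos_right hlt hpos
      linarith
    set F := polyFrob D ^ 2
    have h8 : 2 * ((m : ℝ) + 1 + 1) ^ 3 ≤ 9 * ((m : ℝ) + 1) ^ 2 := by
      have a1 := mul_le_mul_of_nonneg_left h7 (show (0 : ℝ) ≤ 2 * ((m : ℝ) + 1 + 1) ^ 3 by positivity)
      have a2 := mul_le_mul_of_nonneg_left h3.le (show (0 : ℝ) ≤ ((m : ℝ) + 1) ^ 2 by positivity)
      nlinarith
    nlinarith [mul_nonneg hm (sq_nonneg ((m : ℝ) - 1)), sq_nonneg ((m : ℝ) - 1)]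
  funext s
  rw [hS, Finset.sum_eq_zero_iff_of_nonneg (fun _ _ => by positivity)] at h6
  simpa using h6 s (Finset.mem_univ s)

lemma rank_step {𝕂 : Type*} [RCLike 𝕂] {ι κ : Type*} [Fintype ι] [Fintype κ] [DecidableEq ι]
    [DecidableEq κ] (m : ℕ) (Q : Matrix ι κ (Polynomial 𝕂))
    (B : Matrix (Fin (m + 1) × κ) (Fin (1 + m + 1) × ι) 𝕂) (hB : convMat 1 m Q * B = 1) :
    (convMat 1 (m + 1) Q).rank = (m + 3) * Fintype.card ι := by
  have inj : ∀ z, z ᵥ* convMat 1 m Q = 0 → z = 0 := by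
    intro z hz
    have := congrArg (· ᵥ* B) hz
    simpa [Matrix.vecMul_vecMul, hB] using this
  have li : LinearIndependent 𝕂 (convMat 1 (m + 1) Q).row := by
    rw [← Matrix.vecMul_injective_iff]
    rw [← Matrix.coe_vecMulLinear, injective_iff_map_eq_zero]
    intro y hy
    rw [Matrix.vecMulLinear_apply] at hy
    have hy' : ∀ (c : Fin (m + 1 + 1)) (q : κ), ∑ r : Fin ((1 + m + 1) + 1), ∑ p,
        y (r, p) * convMat 1 (m + 1) Q (r, p) (c, q) = 0 := by
      intro c q
      have h := congrFun hy (c, q)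
      simp only [Matrix.vecMul, dotProduct, Pi.zero_apply, Fintype.sum_prod_type] at h
      exact h
    have ha : (fun s : Fin (1 + m + 1) × ι => y (s.1.castSucc, s.2)) = 0 := by
      apply inj
      funext ⟨c, q⟩
      have h := hy' c.castSucc q
      simp only [Matrix.vecMul, dotProduct, Pi.zero_apply, Fintype.sum_prod_type]
      rw [Fin.sum_univ_castSucc] at h
      have hz : ∑ p, y (Fin.last (1 + m + 1), p) *
          convMat 1 (m + 1) Q (Fin.last (1 + m + 1), p) (c.castSucc, q) = 0 := by
        refine Finset.sum_eq_zero fun p _ => ?_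
        have : ¬ (1 + m + 1 ≤ (c : ℕ) + 1) := by have := c.2; omega
        simp [convMat, this]
      rw [hz, add_zero] at h
      exact h
    have hb : (fun s : Fin (1 + m + 1) × ι => y (s.1.succ, s.2)) = 0 := by
      apply inj
      funext ⟨c, q⟩
      have h := hy' c.succ q
      simp only [Matrix.vecMul, dotProduct, Pi.zero_apply, Fintype.sum_prod_type]
      rw [Fin.sum_univ_succ] at h
      have hz : ∑ p, y ((0 : Fin (1 + m + 1 + 1)), p) *
          convMat 1 (m + 1) Q ((0 : Fin (1 + m + 1 + 1)), p) (c.succ, q) = 0 := by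
        refine Finset.sum_eq_zero fun p _ => ?_
        simp [convMat]
      rw [hz, zero_add] at h
      rw [← h]
      refine Finset.sum_congr rfl fun r _ => Finset.sum_congr rfl fun p _ => ?_
      congr 1
      simp only [convMat, Matrix.of_apply, Fin.val_succ]
      have e1 : 1 + ((c : ℕ) + 1) - ((r : ℕ) + 1) = 1 + c - r := by omega
      rw [e1]
      refine if_congr ?_ rfl rfl
      omega
    funext ⟨r, p⟩
    rcases Fin.eq_zero_or_eq_succ (n := 1 + m + 1) r with h | ⟨r', h⟩
    · have := congrFun ha ((0 : Fin (1 + m + 1)), p)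
      subst h
      exact this
    · have := congrFun hb (r', p)
      subst h
      exact this
  rw [li.rank_matrix]
  simp
  left; omega

theorem statement_14 {𝕂 : Type*} [RCLike 𝕂] (n ε : ℕ) (hn : 1 ≤ n) (hε : 1 ≤ ε)
    (ΔL21 : Matrix (Fin ε × Fin n) (Fin (ε + 1) × Fin n) (Polynomial 𝕂))
    (hdeg : ∀ i j, (ΔL21 i j).natDegree ≤ 1)
    (hsmall : polyFrob ΔL21 < 3 / (2 * ((ε : ℝ) + 1) ^ ((3 : ℝ) / 2))) :
    (∃ B : Matrix (Fin (ε - 1 + 1) × (Fin (ε + 1) × Fin n))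
        (Fin (1 + (ε - 1) + 1) × (Fin ε × Fin n)) 𝕂,
      convMat 1 (ε - 1)
          ((Lk 𝕂 ε) ⊗ₖ (1 : Matrix (Fin n) (Fin n) (Polynomial 𝕂)) + ΔL21) * B = 1 ∧
      B * convMat 1 (ε - 1)
          ((Lk 𝕂 ε) ⊗ₖ (1 : Matrix (Fin n) (Fin n) (Polynomial 𝕂)) + ΔL21) = 1) ∧
    (convMat 1 ε ((Lk 𝕂 ε) ⊗ₖ (1 : Matrix (Fin n) (Fin n) (Polynomial 𝕂)) + ΔL21)).rank
      = ε * (ε + 2) * n := by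
  obtain ⟨m, rfl⟩ : ∃ m, ε = m + 1 := ⟨ε - 1, by omega⟩
  have hinj := conv_inj n m ΔL21 hdeg hsmall
  set Q := (Lk 𝕂 (m + 1)) ⊗ₖ (1 : Matrix (Fin n) (Fin n) (Polynomial 𝕂)) + ΔL21 with hQ
  have hk : LinearMap.ker (Matrix.toLin' (convMat 1 m Q)) = ⊥ := by
    rw [LinearMap.ker_eq_bot']
    intro x hx
    exact hinj x (by simpa using hx)
  obtain ⟨g, hg⟩ := LinearMap.exists_leftInverse_of_injective _ hk
  have h1 : LinearMap.toMatrix' g * convMat 1 m Q = 1 := by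
    have := congrArg LinearMap.toMatrix' hg
    rwa [LinearMap.toMatrix'_comp, LinearMap.toMatrix'_toLin', LinearMap.toMatrix'_id] at this
  have h2 : convMat 1 m Q * LinearMap.toMatrix' g = 1 := by
    rw [Matrix.mul_eq_one_comm_of_card_eq]
    · exact h1
    · simp; ring
  refine ⟨⟨_, h2, h1⟩, ?_⟩
  rw [rank_step m Q _ h2]
  simp; ring
end

section
/- Let 𝕂 be ℝ or ℂ, n ≥ 1, ε ≥ 1, and let ΔL_{21}(λ) be any pencil of size εn×(ε+1)n over 𝕂 with ‖ΔL_{21}(λ)‖_F < 1/(2(ε+1)^{3/2}). Then there exists a matrix polynomial ΔR_ε(λ) ∈ 𝕂[λ]^{(ε+1)n×n} of grade ε such that (L_ε(λ)⊗I_n + ΔL_{21}(λ))·(Λ_ε(λ)⊗I_n + ΔR_ε(λ)) = 0 identically and ‖ΔR_ε(λ)‖_F ≤ √2·(ε+1)·‖ΔL_{21}(λ)‖_F < 1/√2. -/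
open Polynomial Matrix
open scoped Kronecker

section helpers
variable {𝕂 : Type*} [RCLike 𝕂]

noncomputable def rr (ε : ℕ) (y : Fin ε → ℕ → 𝕂) (i k : ℕ) : 𝕂 :=
  if i + k ≤ ε then
    -∑ j ∈ Finset.univ.filter (fun j : Fin ε => i ≤ (j : ℕ) ∧ (j : ℕ) ≤ i + k), y j (i + k - j)
  else ∑ j ∈ Finset.univ.filter (fun j : Fin ε => (j : ℕ) < i), y j (i + k - j)

lemma rr_add (ε : ℕ) (y z : Fin ε → ℕ → 𝕂) (i k : ℕ) :
    rr ε (fun j l => y j l + z j l) i k = rr ε y i k + rr ε z i k := by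
  unfold rr
  split_ifs <;> rw [Finset.sum_add_distrib]
  ring

lemma rr_smul (ε : ℕ) (c : 𝕂) (y : Fin ε → ℕ → 𝕂) (i k : ℕ) :
    rr ε (fun j l => c * y j l) i k = c * rr ε y i k := by
  unfold rr
  split_ifs <;> rw [← Finset.mul_sum]
  ring

lemma rr_zero (ε : ℕ) (y : Fin ε → ℕ → 𝕂) (hy : ∀ j l, ε + 1 < l → y j l = 0) (i k : ℕ)
    (hk : ε < k) : rr ε y i k = 0 := by
  unfold rr
  rw [if_neg (by omega)]
  apply Finset.sum_eq_zero
  intro j hj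
  simp only [Finset.mem_filter, Finset.mem_univ, true_and] at hj
  apply hy; omega

lemma rr_solve_succ (ε : ℕ) (y : Fin ε → ℕ → 𝕂) (j : Fin ε) (l : ℕ) :
    -rr ε y j (l + 1) + rr ε y (j + 1) l = y j (l + 1) := by
  unfold rr
  have e : (j : ℕ) + 1 + l = j + (l + 1) := by ring
  rw [e]
  split_ifs with h
  · have : Finset.univ.filter (fun i : Fin ε => (j : ℕ) ≤ (i : ℕ) ∧ (i : ℕ) ≤ j + (l + 1))
      = insert j (Finset.univ.filter (fun i : Fin ε => (j : ℕ) + 1 ≤ (i : ℕ) ∧ (i : ℕ) ≤ j + (l + 1))) := by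
      ext i; simp [Fin.ext_iff]; omega
    rw [this, Finset.sum_insert (by simp)]
    simp
  · have : Finset.univ.filter (fun i : Fin ε => (i : ℕ) < j + 1)
      = insert j (Finset.univ.filter (fun i : Fin ε => (i : ℕ) < j)) := by
      ext i; simp [Fin.ext_iff]; omega
    rw [this, Finset.sum_insert (by simp)]
    simp

lemma rr_solve_zero (ε : ℕ) (y : Fin ε → ℕ → 𝕂) (j : Fin ε) :
    -rr ε y j 0 = y j 0 := by
  unfold rr
  rw [if_pos (by omega)]
  have : Finset.univ.filter (fun i : Fin ε => (j : ℕ) ≤ (i : ℕ) ∧ (i : ℕ) ≤ j + 0) = {j} := by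
    ext i; simp [Fin.ext_iff]; omega
  rw [this]; simp

lemma norm_sum_sq_le {ι : Type*} (s : Finset ι) (f : ι → 𝕂) :
    ‖∑ i ∈ s, f i‖ ^ 2 ≤ (s.card : ℝ) * ∑ i ∈ s, ‖f i‖ ^ 2 :=
  (pow_le_pow_left₀ (norm_nonneg _) (norm_sum_le _ _) 2).trans sq_sum_le_card_mul_sum_sq

noncomputable def NN (ε : ℕ) (y : Fin ε → ℕ → 𝕂) (s : ℕ) : ℝ :=
  ∑ j : Fin ε, if (j : ℕ) ≤ s then ‖y j (s - j)‖ ^ 2 else 0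

noncomputable def ww (ε i s : ℕ) : ℝ := if s ≤ ε then ((ε - i : ℕ) : ℝ) else (i : ℝ)

lemma NN_nonneg (ε : ℕ) (y : Fin ε → ℕ → 𝕂) (s : ℕ) : 0 ≤ NN ε y s := by
  unfold NN; apply Finset.sum_nonneg; intro j _; split_ifs <;> positivity

lemma ww_nonneg (ε i s : ℕ) : 0 ≤ ww ε i s := by
  unfold ww; split_ifs <;> positivity

lemma rr_le (ε : ℕ) (y : Fin ε → ℕ → 𝕂) (i k : ℕ) :
    ‖rr ε y i k‖ ^ 2 ≤ ww ε i (i + k) * NN ε y (i + k) := by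
  have hN : ∀ t : Finset (Fin ε), (∀ j ∈ t, (j : ℕ) ≤ i + k) →
      ∑ j ∈ t, ‖y j (i + k - j)‖ ^ 2 ≤ NN ε y (i + k) := by
    intro t ht
    unfold NN
    calc _ = ∑ j ∈ t, if (j : ℕ) ≤ i + k then ‖y j (i + k - j)‖ ^ 2 else 0 := by
            apply Finset.sum_congr rfl; intro j hj; rw [if_pos (ht j hj)]
      _ ≤ _ := by
        apply Finset.sum_le_sum_of_subset_of_nonneg (Finset.subset_univ _)
        intro j _ _; split_ifs <;> positivity
  have hcard : ∀ (t : Finset (Fin ε)) (u : Finset ℕ), (∀ j ∈ t, (j : ℕ) ∈ u) →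
      t.card ≤ u.card := by
    intro t u h
    exact Finset.card_le_card_of_injOn (fun j => (j : ℕ)) h (fun a _ b _ h => Fin.ext h)
  unfold rr ww
  split_ifs with h
  · rw [norm_neg]
    refine (norm_sum_sq_le _ _).trans ?_
    apply mul_le_mul _ (hN _ _) (by positivity) (by positivity)
    · have := hcard (Finset.univ.filter (fun j : Fin ε => i ≤ (j : ℕ) ∧ (j : ℕ) ≤ i + k))
        (Finset.Ico i ε) (by intro j hj; simp at hj ⊢; omega)
      rw [Nat.card_Ico] at this
      exact_mod_cast this
    · intro j hj; simp at hj; omega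
  · refine (norm_sum_sq_le _ _).trans ?_
    apply mul_le_mul _ (hN _ _) (by positivity) (by positivity)
    · have := hcard (Finset.univ.filter (fun j : Fin ε => (j : ℕ) < i))
        (Finset.range i) (by intro j hj; simpa using hj)
      rw [Finset.card_range] at this
      exact_mod_cast this
    · intro j hj; simp at hj; omega

lemma ww_sum (ε s : ℕ) : ∑ i ∈ Finset.range (ε + 1), ww ε i s = (ε : ℝ) * (ε + 1) / 2 := by
  have h : ∑ i ∈ Finset.range (ε + 1), (i : ℝ) = (ε : ℝ) * (ε + 1) / 2 := by
    induction ε with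
    | zero => simp
    | succ m ih => rw [Finset.sum_range_succ, ih]; push_cast; ring
  unfold ww
  split_ifs
  · rw [← h, ← Finset.sum_range_reflect]
    apply Finset.sum_congr rfl
    intro i hi
    simp only [Finset.mem_range] at hi
    congr 1
    omega
  · exact h

lemma rr_norm (ε : ℕ) (y : Fin ε → ℕ → 𝕂) (hy : ∀ j l, ε + 1 < l → y j l = 0) :
    ∑ i : Fin (ε + 1), ∑ k ∈ Finset.range (ε + 1), ‖rr ε y i k‖ ^ 2 ≤
      (ε : ℝ) * (ε + 1) / 2 * ∑ j, ∑ l ∈ Finset.range (ε + 2), ‖y j l‖ ^ 2 := by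
  have hN : ∑ s ∈ Finset.range (2 * ε + 2), NN ε y s ≤
      ∑ j, ∑ l ∈ Finset.range (ε + 2), ‖y j l‖ ^ 2 := by
    unfold NN
    rw [Finset.sum_comm]
    apply Finset.sum_le_sum
    intro j _
    rw [← Finset.sum_filter]
    have : (Finset.range (2 * ε + 2)).filter (fun s => (j : ℕ) ≤ s) =
        Finset.Ico (j : ℕ) (2 * ε + 2) := by
      ext s; simp; omega
    rw [this, Finset.sum_Ico_eq_sum_range]
    simp only [Nat.add_sub_cancel_left]
    apply le_of_eq
    symm
    apply Finset.sum_subset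
    · intro l; simp only [Finset.mem_range]; omega
    · intro l _ hl
      simp only [Finset.mem_range] at hl
      rw [hy j l (by omega)]; simp
  calc _ = ∑ i ∈ Finset.range (ε + 1), ∑ k ∈ Finset.range (ε + 1), ‖rr ε y i k‖ ^ 2 := by
        rw [Finset.sum_range (fun i => ∑ k ∈ Finset.range (ε + 1), ‖rr ε y i k‖ ^ 2)]
    _ ≤ ∑ i ∈ Finset.range (ε + 1), ∑ s ∈ Finset.range (2 * ε + 2), ww ε i s * NN ε y s := by
        apply Finset.sum_le_sum
        intro i hi
        simp only [Finset.mem_range] at hi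
        calc _ ≤ ∑ k ∈ Finset.range (ε + 1), ww ε i (i + k) * NN ε y (i + k) :=
              Finset.sum_le_sum (fun k _ => rr_le ε y i k)
          _ = ∑ s ∈ Finset.Ico i (i + (ε + 1)), ww ε i s * NN ε y s := by
              rw [Finset.sum_Ico_eq_sum_range]; simp
          _ ≤ _ := by
              apply Finset.sum_le_sum_of_subset_of_nonneg
              · intro s; simp only [Finset.mem_range, Finset.mem_Ico]; omega
              · intro s _ _; exact mul_nonneg (ww_nonneg _ _ _) (NN_nonneg _ _ _)
    _ = (ε : ℝ) * (ε + 1) / 2 * ∑ s ∈ Finset.range (2 * ε + 2), NN ε y s := by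
        rw [Finset.sum_comm, Finset.mul_sum]
        apply Finset.sum_congr rfl
        intro s _
        rw [← Finset.sum_mul, ww_sum]
    _ ≤ _ := by gcongr

lemma abstract_solve {F : Type*} [NormedAddCommGroup F] [NormedSpace 𝕂 F] [FiniteDimensional 𝕂 F]
    (Ψ : F →ₗ[𝕂] F) (q : ℝ) (hq : q < 1) (h : ∀ z, ‖Ψ z‖ ≤ q * ‖z‖) (y : F) :
    ∃ z, z + Ψ z = y ∧ (1 - q) * ‖z‖ ≤ ‖y‖ := by
  have key : ∀ z, (1 - q) * ‖z‖ ≤ ‖z + Ψ z‖ := by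
    intro z
    have h1 : ‖z‖ ≤ ‖z + Ψ z‖ + ‖Ψ z‖ := by
      simpa using norm_sub_le (z + Ψ z) (Ψ z)
    linarith [h z]
  have inj : Function.Injective (LinearMap.id + Ψ : F →ₗ[𝕂] F) := by
    rw [← LinearMap.ker_eq_bot, LinearMap.ker_eq_bot']
    intro z hz
    have := key z
    have hz' : z + Ψ z = 0 := hz
    rw [hz', norm_zero] at this
    have : ‖z‖ ≤ 0 := by
      by_contra hh
      push Not at hh
      nlinarith
    exact norm_le_zero_iff.1 this
  obtain ⟨z, hz⟩ := (LinearMap.injective_iff_surjective.1 inj) y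
  have hz' : z + Ψ z = y := hz
  exact ⟨z, hz', hz' ▸ key z⟩

/-- coefficient square sum up to degree `D` -/
noncomputable def vsq {ι : Type*} [Fintype ι] (D : ℕ) (v : ι → 𝕂[X]) : ℝ :=
  ∑ i, ∑ k ∈ Finset.range (D + 1), ‖(v i).coeff k‖ ^ 2

lemma vsq_nonneg {ι : Type*} [Fintype ι] (D : ℕ) (v : ι → 𝕂[X]) : 0 ≤ vsq D v := by
  unfold vsq; positivity

lemma support_sum (p : 𝕂[X]) (D : ℕ) (h : p.natDegree ≤ D) :
    ∑ k ∈ p.support, ‖p.coeff k‖ ^ 2 = ∑ k ∈ Finset.range (D + 1), ‖p.coeff k‖ ^ 2 := by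
  apply Finset.sum_subset
  · intro k hk
    have := Polynomial.le_natDegree_of_mem_supp k hk
    simp only [Finset.mem_range]; omega
  · intro k _ hk
    rw [Polynomial.notMem_support_iff.1 hk]; simp

lemma coeff_mul_deg1 (p x : 𝕂[X]) (hp : p.natDegree ≤ 1) (k : ℕ) :
    (p * x).coeff k = p.coeff 0 * x.coeff k +
      p.coeff 1 * (if k = 0 then 0 else x.coeff (k - 1)) := by
  rw [Polynomial.eq_X_add_C_of_natDegree_le_one hp]
  rcases k with _ | k
  · simp
  · simp [add_mul, mul_assoc, Polynomial.coeff_X_mul]; ring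

lemma mulVec_bound {κ ι : Type*} [Fintype κ] [Fintype ι] (M : Matrix κ ι 𝕂[X])
    (hM : ∀ i j, (M i j).natDegree ≤ 1) (D : ℕ) (x : ι → 𝕂[X]) :
    vsq D (M *ᵥ x) ≤ 2 * (polyFrob M) ^ 2 * vsq D x := by
  have hF : (polyFrob M) ^ 2 = ∑ j, ∑ i, (‖(M j i).coeff 0‖ ^ 2 + ‖(M j i).coeff 1‖ ^ 2) := by
    unfold polyFrob
    rw [Real.sq_sqrt (by positivity)]
    refine Finset.sum_congr rfl fun j _ => Finset.sum_congr rfl fun i _ => ?_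
    rw [support_sum _ 1 (hM j i)]
    simp [Finset.sum_range_succ]
  set x' : ι → ℕ → 𝕂 := fun i k => if k = 0 then 0 else (x i).coeff (k - 1) with hx'
  have h1 : ∀ j k, ‖((M *ᵥ x) j).coeff k‖ ^ 2 ≤
      (∑ i, (‖(M j i).coeff 0‖ ^ 2 + ‖(M j i).coeff 1‖ ^ 2)) *
      (∑ i, (‖(x i).coeff k‖ ^ 2 + ‖x' i k‖ ^ 2)) := by
    intro j k
    have e : ((M *ᵥ x) j).coeff k = ∑ i : ι, ∑ b : Bool,
        (if b then (M j i).coeff 1 else (M j i).coeff 0) *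
        (if b then x' i k else (x i).coeff k) := by
      simp only [Matrix.mulVec, dotProduct, Polynomial.finsetSum_coeff]
      refine Finset.sum_congr rfl fun i _ => ?_
      rw [coeff_mul_deg1 _ _ (hM j i)]
      simp [hx', add_comm]
    have cs := Finset.sum_mul_sq_le_sq_mul_sq (Finset.univ : Finset (ι × Bool))
      (fun p => ‖if p.2 then (M j p.1).coeff 1 else (M j p.1).coeff 0‖)
      (fun p => ‖if p.2 then x' p.1 k else (x p.1).coeff k‖)
    simp only [Fintype.sum_prod_type] at cs
    have t : ‖((M *ᵥ x) j).coeff k‖ ≤ ∑ i : ι, ∑ b : Bool,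
        ‖(if b then (M j i).coeff 1 else (M j i).coeff 0)‖ *
        ‖(if b then x' i k else (x i).coeff k)‖ := by
      rw [e]
      refine (norm_sum_le _ _).trans (Finset.sum_le_sum fun i _ => (norm_sum_le _ _).trans
        (Finset.sum_le_sum fun b _ => (norm_mul_le _ _)))
    refine (pow_le_pow_left₀ (norm_nonneg _) t 2).trans (cs.trans (le_of_eq ?_))
    simp [add_comm]
  have h2 : ∑ k ∈ Finset.range (D + 1), ∑ i, (‖(x i).coeff k‖ ^ 2 + ‖x' i k‖ ^ 2) ≤
      2 * vsq D x := by
    unfold vsq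
    rw [Finset.sum_comm, Finset.mul_sum]
    apply Finset.sum_le_sum
    intro i _
    rw [Finset.sum_add_distrib, two_mul]
    apply add_le_add_right
    rw [Finset.sum_range_succ']
    simp only [hx']
    simp only [Nat.add_eq_zero_iff, one_ne_zero, and_false, if_false, Nat.add_sub_cancel, if_true,
      norm_zero]
    rw [Finset.sum_range_succ]
    have : 0 ≤ ‖(x i).coeff D‖ ^ 2 := by positivity
    simpa using this
  calc vsq D (M *ᵥ x) ≤ ∑ j, ∑ k ∈ Finset.range (D + 1),
      (∑ i, (‖(M j i).coeff 0‖ ^ 2 + ‖(M j i).coeff 1‖ ^ 2)) *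
      (∑ i, (‖(x i).coeff k‖ ^ 2 + ‖x' i k‖ ^ 2)) :=
        Finset.sum_le_sum fun j _ => Finset.sum_le_sum fun k _ => h1 j k
    _ = (polyFrob M) ^ 2 *
        ∑ k ∈ Finset.range (D + 1), ∑ i, (‖(x i).coeff k‖ ^ 2 + ‖x' i k‖ ^ 2) := by
        rw [hF, Finset.sum_mul_sum]
    _ ≤ (polyFrob M) ^ 2 * (2 * vsq D x) := by gcongr
    _ = _ := by ring

/-- right inverse -/
noncomputable def SS (ε n : ℕ) :
    (Fin ε × Fin n → 𝕂[X]) →ₗ[𝕂] (Fin (ε + 1) × Fin n → 𝕂[X]) where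
  toFun z := fun p => ∑ k ∈ Finset.range (ε + 1),
    Polynomial.monomial k (rr ε (fun j l => (z (j, p.2)).coeff l) p.1 k)
  map_add' z w := by
    ext1 p
    simp only [Pi.add_apply, Polynomial.coeff_add, rr_add, map_add,
      Finset.sum_add_distrib]
  map_smul' c z := by
    ext1 p
    simp only [Pi.smul_apply, Polynomial.coeff_smul, smul_eq_mul, rr_smul, RingHom.id_apply,
      Finset.smul_sum, Polynomial.smul_monomial]

lemma SS_coeff (ε n : ℕ) (z : Fin ε × Fin n → 𝕂[X]) (p) (k : ℕ) :
    (SS ε n z p).coeff k =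
      if k < ε + 1 then rr ε (fun j l => (z (j, p.2)).coeff l) p.1 k else 0 := by
  simp [SS, Polynomial.finsetSum_coeff, Polynomial.coeff_monomial]

lemma SS_deg (ε n : ℕ) (z : Fin ε × Fin n → 𝕂[X]) (p) : (SS ε n z p).natDegree ≤ ε := by
  rw [Polynomial.natDegree_le_iff_coeff_eq_zero]
  intro k hk
  rw [SS_coeff, if_neg (by omega)]

lemma SS_bound (ε n : ℕ) (z : Fin ε × Fin n → 𝕂[X]) (hz : ∀ p, (z p).natDegree ≤ ε + 1) :
    vsq (ε + 1) (SS ε n z) ≤ (ε : ℝ) * (ε + 1) / 2 * vsq (ε + 1) z := by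
  unfold vsq
  simp only [Fintype.sum_prod_type]
  rw [Finset.sum_comm, Finset.sum_comm (s := (Finset.univ : Finset (Fin ε))), Finset.mul_sum]
  apply Finset.sum_le_sum
  intro a _
  refine le_trans (le_of_eq ?_) (rr_norm ε (fun j l => (z (j, a)).coeff l) ?_)
  · apply Finset.sum_congr rfl
    intro i _
    rw [Finset.sum_range_succ]
    simp only [SS_coeff]
    simp only [lt_irrefl, if_false, norm_zero]
    rw [zero_pow two_ne_zero, add_zero]
    apply Finset.sum_congr rfl
    intro k hk
    rw [if_pos (by simpa using hk)]
  · intro j l hl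
    exact Polynomial.coeff_eq_zero_of_natDegree_lt (lt_of_le_of_lt (hz _) hl)

lemma Lk_mulVec (ε n : ℕ) (x : Fin (ε + 1) × Fin n → 𝕂[X]) (j : Fin ε) (a : Fin n) :
    (((Lk 𝕂 ε) ⊗ₖ (1 : Matrix (Fin n) (Fin n) (Polynomial 𝕂))) *ᵥ x) (j, a) =
      -x (j.castSucc, a) + Polynomial.X * x (j.succ, a) := by
  simp only [Matrix.mulVec, dotProduct, Fintype.sum_prod_type, Matrix.kroneckerMap_apply,
    Matrix.one_apply, mul_ite, mul_one, mul_zero, ite_mul, zero_mul, Finset.sum_ite_eq,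
    Finset.mem_univ, if_true]
  have : ∀ i : Fin (ε + 1), Lk 𝕂 ε j i * x (i, a) =
      (if i = j.castSucc then -x (i, a) else 0) +
      (if i = j.succ then Polynomial.X * x (i, a) else 0) := by
    intro i
    simp only [Lk, Matrix.of_apply, Fin.ext_iff, Fin.val_castSucc, Fin.val_succ]
    split_ifs <;> first | omega | simp
  simp only [this, Finset.sum_add_distrib]
  simp

lemma Lk_SS (ε n : ℕ) (z : Fin ε × Fin n → 𝕂[X]) (hz : ∀ p, (z p).natDegree ≤ ε + 1) :
    ((Lk 𝕂 ε) ⊗ₖ (1 : Matrix (Fin n) (Fin n) (Polynomial 𝕂))) *ᵥ (SS ε n z) = z := by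
  ext1 ⟨j, a⟩
  have hy : ∀ (j : Fin ε) l, ε + 1 < l → (fun (j : Fin ε) l => (z (j, a)).coeff l) j l = 0 :=
    fun j l hl => Polynomial.coeff_eq_zero_of_natDegree_lt (lt_of_le_of_lt (hz _) hl)
  have hc : ∀ (i : Fin (ε + 1)) k, (SS ε n z (i, a)).coeff k =
      rr ε (fun j l => (z (j, a)).coeff l) i k := by
    intro i k
    rw [SS_coeff]
    split_ifs with h
    · rfl
    · rw [rr_zero ε _ hy _ _ (by omega)]
  rw [Lk_mulVec]
  ext k
  rcases k with _ | k
  · simp only [Polynomial.coeff_add, Polynomial.coeff_neg, Polynomial.coeff_X_mul_zero, hc,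
      add_zero]
    exact rr_solve_zero ε (fun j l => (z (j, a)).coeff l) j
  · simp only [Polynomial.coeff_add, Polynomial.coeff_neg, Polynomial.coeff_X_mul, hc]
    exact rr_solve_succ ε (fun j l => (z (j, a)).coeff l) j k

/-- coefficients as Euclidean vector -/
noncomputable def toE (κ : Type*) [Fintype κ] (D : ℕ) :
    (κ → 𝕂[X]) →ₗ[𝕂] EuclideanSpace 𝕂 (κ × Fin (D + 1)) where
  toFun v := WithLp.toLp 2 (fun p => (v p.1).coeff p.2)
  map_add' v w := by ext p; simp
  map_smul' c v := by ext p; simp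

noncomputable def ofE (κ : Type*) [Fintype κ] (D : ℕ) :
    EuclideanSpace 𝕂 (κ × Fin (D + 1)) →ₗ[𝕂] (κ → 𝕂[X]) where
  toFun v := fun j => ∑ k : Fin (D + 1), Polynomial.monomial k (v (j, k))
  map_add' v w := by ext1 p; simp [Finset.sum_add_distrib]
  map_smul' c v := by ext1 p; simp [Finset.smul_sum, Polynomial.smul_monomial]

lemma toE_norm {κ : Type*} [Fintype κ] (D : ℕ) (v : κ → 𝕂[X]) :
    ‖toE κ D v‖ = √(vsq D v) := by
  rw [EuclideanSpace.norm_eq]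
  congr 1
  simp only [toE, vsq, Fintype.sum_prod_type, Finset.sum_range]
  rfl

lemma ofE_deg {κ : Type*} [Fintype κ] (D : ℕ) (v : EuclideanSpace 𝕂 (κ × Fin (D + 1))) (j : κ) :
    (ofE κ D v j).natDegree ≤ D := by
  change (∑ k : Fin (D + 1), Polynomial.monomial (k : ℕ) (v (j, k))).natDegree ≤ D
  apply Polynomial.natDegree_sum_le_of_forall_le
  intro k _
  exact (Polynomial.natDegree_monomial_le _).trans (by omega)

lemma toE_ofE {κ : Type*} [Fintype κ] (D : ℕ) (v : EuclideanSpace 𝕂 (κ × Fin (D + 1))) :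
    toE κ D (ofE κ D v) = v := by
  ext ⟨j, k⟩
  simp [toE, ofE, Polynomial.finsetSum_coeff, Polynomial.coeff_monomial, Fin.val_inj]

lemma toE_inj {κ : Type*} [Fintype κ] (D : ℕ) (v w : κ → 𝕂[X]) (hv : ∀ j, (v j).natDegree ≤ D)
    (hw : ∀ j, (w j).natDegree ≤ D) (h : toE κ D v = toE κ D w) : v = w := by
  ext j k
  by_cases hk : k < D + 1
  · have := congrArg (fun u => u (j, (⟨k, hk⟩ : Fin (D + 1)))) h
    simpa [toE] using this
  · rw [Polynomial.coeff_eq_zero_of_natDegree_lt (lt_of_le_of_lt (hv _) (by omega)),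
      Polynomial.coeff_eq_zero_of_natDegree_lt (lt_of_le_of_lt (hw _) (by omega))]

lemma mulVec_deg {κ ι : Type*} [Fintype κ] [Fintype ι] (M : Matrix κ ι 𝕂[X])
    (hM : ∀ i j, (M i j).natDegree ≤ 1) (D : ℕ) (x : ι → 𝕂[X]) (hx : ∀ i, (x i).natDegree ≤ D)
    (j : κ) : ((M *ᵥ x) j).natDegree ≤ D + 1 := by
  apply Polynomial.natDegree_sum_le_of_forall_le
  intro i _
  refine Polynomial.natDegree_mul_le.trans ?_
  exact (add_le_add (hM j i) (hx i)).trans (by omega)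

lemma column_solve (n ε : ℕ) (M : Matrix (Fin ε × Fin n) (Fin (ε + 1) × Fin n) 𝕂[X])
    (hM : ∀ i j, (M i j).natDegree ≤ 1)
    (hq : √((ε : ℝ) * (ε + 1) / 2) * (√2 * polyFrob M) < 1)
    (b : Fin ε × Fin n → 𝕂[X]) (hb : ∀ j, (b j).natDegree ≤ ε + 1) :
    ∃ x : Fin (ε + 1) × Fin n → 𝕂[X], (∀ i, (x i).natDegree ≤ ε) ∧
      ((Lk 𝕂 ε) ⊗ₖ (1 : Matrix (Fin n) (Fin n) (Polynomial 𝕂)) + M) *ᵥ x = b ∧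
      (1 - √((ε : ℝ) * (ε + 1) / 2) * (√2 * polyFrob M)) * √(vsq (ε + 1) x) ≤
        √((ε : ℝ) * (ε + 1) / 2) * √(vsq (ε + 1) b) := by
  set C := √((ε : ℝ) * (ε + 1) / 2) with hC
  have hC0 : 0 ≤ C := Real.sqrt_nonneg _
  have hF0 : 0 ≤ polyFrob M := Real.sqrt_nonneg _
  have hMb : ∀ x, √(vsq (ε + 1) (M *ᵥ x)) ≤ √2 * polyFrob M * √(vsq (ε + 1) x) := by
    intro x
    refine (Real.sqrt_le_sqrt (mulVec_bound M hM (ε + 1) x)).trans (le_of_eq ?_)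
    rw [Real.sqrt_mul (by positivity), Real.sqrt_mul (by positivity), Real.sqrt_sq hF0]
  have hSb : ∀ z : EuclideanSpace 𝕂 ((Fin ε × Fin n) × Fin (ε + 1 + 1)),
      √(vsq (ε + 1) (SS ε n (ofE _ _ z))) ≤ C * ‖z‖ := by
    intro z
    refine (Real.sqrt_le_sqrt (SS_bound ε n _ (ofE_deg _ z))).trans (le_of_eq ?_)
    rw [Real.sqrt_mul (by positivity), ← toE_norm, toE_ofE]
  let Mlin : (Fin (ε + 1) × Fin n → 𝕂[X]) →ₗ[𝕂] (Fin ε × Fin n → 𝕂[X]) :=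
    { toFun := fun x => M *ᵥ x
      map_add' := fun x y => Matrix.mulVec_add M x y
      map_smul' := fun c x => Matrix.mulVec_smul M c x }
  let Ψ := (toE (Fin ε × Fin n) (ε + 1)) ∘ₗ Mlin ∘ₗ (SS ε n) ∘ₗ (ofE (Fin ε × Fin n) (ε + 1))
  have hΨ : ∀ z, ‖Ψ z‖ ≤ C * (√2 * polyFrob M) * ‖z‖ := by
    intro z
    change ‖toE (Fin ε × Fin n) (ε + 1) (M *ᵥ (SS ε n (ofE _ _ z)))‖ ≤ _
    rw [toE_norm]
    refine (hMb _).trans ?_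
    calc _ ≤ √2 * polyFrob M * (C * ‖z‖) := by gcongr; exact hSb z
      _ = _ := by ring
  obtain ⟨z, hz, hzn⟩ := abstract_solve Ψ _ hq hΨ (toE _ _ b)
  refine ⟨SS ε n (ofE _ _ z), SS_deg _ _ _, ?_, ?_⟩
  · rw [Matrix.add_mulVec, Lk_SS _ _ _ (ofE_deg _ z)]
    apply toE_inj (ε + 1) _ _ _ hb
    · rw [map_add, toE_ofE]; exact hz
    · intro j
      exact (Polynomial.natDegree_add_le _ _).trans
        (max_le (ofE_deg _ z j) (mulVec_deg M hM ε _ (SS_deg _ _ _) j))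
  · rw [toE_norm] at hzn
    calc _ ≤ (1 - C * (√2 * polyFrob M)) * (C * ‖z‖) := by
            apply mul_le_mul_of_nonneg_left (hSb z); linarith
      _ = C * ((1 - C * (√2 * polyFrob M)) * ‖z‖) := by ring
      _ ≤ _ := by gcongr

lemma Lam_col (ε n : ℕ) (i : Fin (ε + 1)) (a : Fin n) (c : Fin 1 × Fin n) :
    ((Lam 𝕂 ε) ⊗ₖ (1 : Matrix (Fin n) (Fin n) (Polynomial 𝕂))) (i, a) c =
      if a = c.2 then Polynomial.X ^ (ε - (i : ℕ)) else 0 := by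
  simp [Lam, Matrix.kroneckerMap_apply, Matrix.one_apply]

lemma MLam_bound (ε n : ℕ) (M : Matrix (Fin ε × Fin n) (Fin (ε + 1) × Fin n) 𝕂[X])
    (hM : ∀ i j, (M i j).natDegree ≤ 1) :
    ∑ c, vsq (ε + 1) (fun j => (M * ((Lam 𝕂 ε) ⊗ₖ
      (1 : Matrix (Fin n) (Fin n) (Polynomial 𝕂)))) j c) ≤ 2 * (polyFrob M) ^ 2 := by
  have e : ∀ j (c : Fin 1 × Fin n) k, ((M * ((Lam 𝕂 ε) ⊗ₖ
      (1 : Matrix (Fin n) (Fin n) (Polynomial 𝕂)))) j c).coeff k =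
      ∑ i ∈ Finset.univ.filter (fun i : Fin (ε + 1) => ε - (i : ℕ) ≤ k ∧ k ≤ ε - (i : ℕ) + 1),
        (M j (i, c.2)).coeff (k - (ε - (i : ℕ))) := by
    intro j c k
    simp only [Matrix.mul_apply, Fintype.sum_prod_type, Lam_col, mul_ite, mul_zero,
      Finset.sum_ite_eq', Finset.mem_univ, if_true, Polynomial.finsetSum_coeff,
      Polynomial.coeff_mul_X_pow']
    rw [Finset.sum_filter]
    apply Finset.sum_congr rfl
    intro i _
    by_cases h1 : ε - (i : ℕ) ≤ k
    · by_cases h2 : k ≤ ε - (i : ℕ) + 1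
      · rw [if_pos h1, if_pos ⟨h1, h2⟩]
      · rw [if_pos h1, if_neg (by tauto)]
        exact Polynomial.coeff_eq_zero_of_natDegree_lt (lt_of_le_of_lt (hM _ _) (by omega))
    · rw [if_neg h1, if_neg (by tauto)]
  have h1 : ∀ j (c : Fin 1 × Fin n) k, ‖((M * ((Lam 𝕂 ε) ⊗ₖ
      (1 : Matrix (Fin n) (Fin n) (Polynomial 𝕂)))) j c).coeff k‖ ^ 2 ≤
      2 * ∑ i : Fin (ε + 1), if ε - (i : ℕ) ≤ k ∧ k ≤ ε - (i : ℕ) + 1 then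
        ‖(M j (i, c.2)).coeff (k - (ε - (i : ℕ)))‖ ^ 2 else 0 := by
    intro j c k
    rw [e]
    refine (norm_sum_sq_le _ _).trans ?_
    rw [← Finset.sum_filter]
    gcongr
    have : (Finset.univ.filter (fun i : Fin (ε + 1) => ε - (i : ℕ) ≤ k ∧ k ≤ ε - (i : ℕ) + 1)).card
        ≤ (Finset.Icc (ε - k) (ε + 1 - k)).card := by
      refine Finset.card_le_card_of_injOn (fun j : Fin (ε + 1) => (j : ℕ)) ?_
        (fun a _ b _ h => Fin.ext h)
      intro i hi
      simp at hi ⊢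
      omega
    rw [Nat.card_Icc] at this
    have : (Finset.univ.filter
      (fun i : Fin (ε + 1) => ε - (i : ℕ) ≤ k ∧ k ≤ ε - (i : ℕ) + 1)).card ≤ 2 := by omega
    exact_mod_cast this
  have h2 : ∀ j (c : Fin n) (i : Fin (ε + 1)), ∑ k ∈ Finset.range (ε + 1 + 1),
      (if ε - (i : ℕ) ≤ k ∧ k ≤ ε - (i : ℕ) + 1 then
        ‖(M j (i, c)).coeff (k - (ε - (i : ℕ)))‖ ^ 2 else 0) =
      ∑ k ∈ (M j (i, c)).support, ‖(M j (i, c)).coeff k‖ ^ 2 := by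
    intro j c i
    rw [support_sum _ 1 (hM _ _), ← Finset.sum_filter]
    have : (Finset.range (ε + 1 + 1)).filter
        (fun k => ε - (i : ℕ) ≤ k ∧ k ≤ ε - (i : ℕ) + 1) =
        Finset.Ico (ε - (i : ℕ)) (ε - (i : ℕ) + 2) := by
      ext k; simp; omega
    rw [this, Finset.sum_Ico_eq_sum_range]
    simp
  have hF : (polyFrob M) ^ 2 = ∑ j, ∑ i, ∑ c, ∑ k ∈ (M j (i, c)).support, ‖(M j (i, c)).coeff k‖ ^ 2 := by
    unfold polyFrob
    rw [Real.sq_sqrt (by positivity)]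
    refine Finset.sum_congr rfl fun j _ => ?_
    rw [Fintype.sum_prod_type]
  calc _ ≤ ∑ c : Fin 1 × Fin n, ∑ j, ∑ k ∈ Finset.range (ε + 1 + 1),
        2 * ∑ i : Fin (ε + 1), (if ε - (i : ℕ) ≤ k ∧ k ≤ ε - (i : ℕ) + 1 then
        ‖(M j (i, c.2)).coeff (k - (ε - (i : ℕ)))‖ ^ 2 else 0) :=
        Finset.sum_le_sum fun c _ => Finset.sum_le_sum fun j _ =>
          Finset.sum_le_sum fun k _ => h1 j c k
    _ = 2 * ∑ c : Fin n, ∑ j, ∑ i, ∑ k ∈ (M j (i, c)).support, ‖(M j (i, c)).coeff k‖ ^ 2 := by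
        rw [Fintype.sum_prod_type]
        simp only [Finset.univ_unique, Finset.sum_singleton, Finset.mul_sum]
        refine Finset.sum_congr rfl fun c _ => Finset.sum_congr rfl fun j _ => ?_
        rw [Finset.sum_comm]
        refine Finset.sum_congr rfl fun i _ => ?_
        rw [← Finset.mul_sum, h2, Finset.mul_sum]
    _ ≤ _ := by
        rw [hF, Finset.sum_comm]
        apply le_of_eq
        congr 1
        refine Finset.sum_congr rfl fun j _ => ?_
        rw [Finset.sum_comm]

lemma Lk_Lam (ε n : ℕ) : ((Lk 𝕂 ε) ⊗ₖ (1 : Matrix (Fin n) (Fin n) (Polynomial 𝕂))) *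
    ((Lam 𝕂 ε) ⊗ₖ (1 : Matrix (Fin n) (Fin n) (Polynomial 𝕂))) = 0 := by
  ext1 ⟨j, a⟩ c
  have := Lk_mulVec ε n (fun i => ((Lam 𝕂 ε) ⊗ₖ
    (1 : Matrix (Fin n) (Fin n) (Polynomial 𝕂))) i c) j a
  refine Eq.trans this ?_
  simp only [Lam_col, Fin.val_castSucc, Fin.val_succ]
  split_ifs
  · rw [← pow_succ', show ε - ((j : ℕ) + 1) + 1 = ε - j by omega]; simp
  · simp

lemma numeric (ε : ℕ) (hε : 1 ≤ ε) (δ : ℝ) (hδ : 0 ≤ δ)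
    (h : δ < 1 / (2 * ((ε : ℝ) + 1) ^ ((3 : ℝ) / 2))) :
    √((ε : ℝ) * (ε + 1) / 2) ≤ ((ε : ℝ) + 1) * (1 - √((ε : ℝ) * (ε + 1) / 2) * (√2 * δ)) ∧
    √2 * ((ε : ℝ) + 1) * δ < 1 / √2 := by
  have hN : (2 : ℝ) ≤ (ε : ℝ) + 1 := by
    have : (1 : ℝ) ≤ ε := by exact_mod_cast hε
    linarith
  have he : (ε : ℝ) = ((ε : ℝ) + 1) - 1 := by ring
  have hs2 : √2 ^ 2 = (2 : ℝ) := Real.sq_sqrt (by norm_num)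
  have hs0 : 0 < √(2 : ℝ) := by positivity
  set N := (ε : ℝ) + 1 with hNdef
  have hN0 : 0 < N := by linarith
  have hpw : (N ^ ((3 : ℝ) / 2)) ^ 2 = N ^ 3 := by
    rw [← Real.rpow_natCast, ← Real.rpow_mul hN0.le, ← Real.rpow_natCast]
    norm_num
  have hp0 : 0 < N ^ ((3 : ℝ) / 2) := by positivity
  set P := N ^ ((3 : ℝ) / 2)
  have h1 : δ * (2 * P) < 1 := by rwa [lt_div_iff₀ (by positivity)] at h
  have h2 : δ ^ 2 * (4 * N ^ 3) < 1 := by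
    have : (δ * (2 * P)) ^ 2 < 1 := by
      have h0 : 0 ≤ δ * (2 * P) := by positivity
      nlinarith
    calc _ = (δ * (2 * P)) ^ 2 := by rw [← hpw]; ring
      _ < 1 := this
  set t := √2 * N * δ with ht
  have ht0 : 0 ≤ t := by positivity
  have ht2 : t ^ 2 * (2 * N) < 1 := by
    calc _ = δ ^ 2 * (4 * N ^ 3) := by rw [ht, mul_pow, mul_pow, hs2]; ring
      _ < 1 := h2
  have ht3 : t ≤ 1 / 2 := by
    by_contra hh
    push Not at hh
    nlinarith [mul_lt_mul'' hh hh (by norm_num) (by norm_num)]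
  constructor
  · have hkey : √((ε : ℝ) * N / 2) * (1 + t) ≤ N := by
      apply (sq_le_sq₀ (by positivity) hN0.le).1
      rw [mul_pow, Real.sq_sqrt (by positivity), he]
      have : (N - 1) * (1 + t) ^ 2 ≤ 2 * N := by nlinarith
      nlinarith
    have : N * (1 - √((ε : ℝ) * N / 2) * (√2 * δ)) = N - √((ε : ℝ) * N / 2) * t := by
      rw [ht]; ring
    rw [this]; linarith
  · rw [lt_div_iff₀ hs0]
    nlinarith

end helpers

theorem statement_15 {𝕂 : Type*} [RCLike 𝕂] (n ε : ℕ) (hn : 1 ≤ n) (hε : 1 ≤ ε)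
    (ΔL21 : Matrix (Fin ε × Fin n) (Fin (ε + 1) × Fin n) (Polynomial 𝕂))
    (hdeg : ∀ i j, (ΔL21 i j).natDegree ≤ 1)
    (hsmall : polyFrob ΔL21 < 1 / (2 * ((ε : ℝ) + 1) ^ ((3 : ℝ) / 2))) :
    ∃ ΔR : Matrix (Fin (ε + 1) × Fin n) (Fin 1 × Fin n) (Polynomial 𝕂),
      (∀ i j, (ΔR i j).natDegree ≤ ε) ∧
      ((Lk 𝕂 ε) ⊗ₖ (1 : Matrix (Fin n) (Fin n) (Polynomial 𝕂)) + ΔL21) *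
        ((Lam 𝕂 ε) ⊗ₖ (1 : Matrix (Fin n) (Fin n) (Polynomial 𝕂)) + ΔR) = 0 ∧
      polyFrob ΔR ≤ Real.sqrt 2 * ((ε : ℝ) + 1) * polyFrob ΔL21 ∧
      polyFrob ΔR < 1 / Real.sqrt 2 := by
  have hF0 : 0 ≤ polyFrob ΔL21 := Real.sqrt_nonneg _
  obtain ⟨hn1, hn2⟩ := numeric ε hε _ hF0 hsmall
  set C := √((ε : ℝ) * (ε + 1) / 2) with hC
  have hC0 : 0 < C := Real.sqrt_pos.2 (by positivity)
  have hN : (0 : ℝ) < (ε : ℝ) + 1 := by positivity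
  have hq0 : 0 < 1 - C * (√2 * polyFrob ΔL21) := by
    by_contra hh
    push Not at hh
    nlinarith
  set B := ΔL21 * ((Lam 𝕂 ε) ⊗ₖ (1 : Matrix (Fin n) (Fin n) (Polynomial 𝕂))) with hB
  have hBdeg : ∀ c j, ((fun j => -B j c) j).natDegree ≤ ε + 1 := by
    intro c j
    rw [Polynomial.natDegree_neg]
    refine mulVec_deg ΔL21 hdeg ε (fun i => ((Lam 𝕂 ε) ⊗ₖ
      (1 : Matrix (Fin n) (Fin n) (Polynomial 𝕂))) i c) ?_ j
    rintro ⟨i, a⟩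
    simp only [Lam_col]
    split_ifs
    · exact (Polynomial.natDegree_X_pow_le _).trans (by omega)
    · simp
  choose x hx1 hx2 hx3 using fun c => column_solve n ε ΔL21 hdeg (by linarith) (fun j => -B j c) (hBdeg c)
  have hle : polyFrob (Matrix.of fun i c => x c i) ≤
      Real.sqrt 2 * ((ε : ℝ) + 1) * polyFrob ΔL21 := by
    have hxs : ∀ c, vsq (ε + 1) (x c) ≤ ((ε : ℝ) + 1) ^ 2 * vsq (ε + 1) (fun j => B j c) := by
      intro c
      have h3 := hx3 c
      have hneg : vsq (ε + 1) (fun j => -B j c) = vsq (ε + 1) (fun j => B j c) := by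
        simp [vsq]
      rw [hneg] at h3
      have h4 : √(vsq (ε + 1) (x c)) ≤ ((ε : ℝ) + 1) * √(vsq (ε + 1) (fun j => B j c)) := by
        have h5 := h3.trans (mul_le_mul_of_nonneg_right hn1 (Real.sqrt_nonneg _))
        have : (1 - C * (√2 * polyFrob ΔL21)) * √(vsq (ε + 1) (x c)) ≤
          (1 - C * (√2 * polyFrob ΔL21)) * (((ε : ℝ) + 1) * √(vsq (ε + 1) (fun j => B j c))) := by
          linarith
        exact le_of_mul_le_mul_left this hq0
      have h6 := pow_le_pow_left₀ (Real.sqrt_nonneg _) h4 2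
      rwa [mul_pow, Real.sq_sqrt (vsq_nonneg _ _), Real.sq_sqrt (vsq_nonneg _ _)] at h6
    unfold polyFrob
    apply Real.sqrt_le_iff.2
    refine ⟨by positivity, ?_⟩
    change _ ≤ (√2 * ((ε : ℝ) + 1) * polyFrob ΔL21) ^ 2
    calc _ = ∑ c, vsq (ε + 1) (x c) := by
          rw [Finset.sum_comm]
          refine Finset.sum_congr rfl fun c _ => Finset.sum_congr rfl fun i _ => ?_
          exact support_sum _ (ε + 1) ((hx1 c i).trans (by omega))
      _ ≤ ∑ c, ((ε : ℝ) + 1) ^ 2 * vsq (ε + 1) (fun j => B j c) :=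
          Finset.sum_le_sum fun c _ => hxs c
      _ = ((ε : ℝ) + 1) ^ 2 * ∑ c, vsq (ε + 1) (fun j => B j c) := by rw [Finset.mul_sum]
      _ ≤ ((ε : ℝ) + 1) ^ 2 * (2 * polyFrob ΔL21 ^ 2) := by
          gcongr; exact MLam_bound ε n ΔL21 hdeg
      _ = _ := by rw [mul_pow, mul_pow, Real.sq_sqrt (by norm_num)]; ring
  refine ⟨Matrix.of fun i c => x c i, fun i c => hx1 c i, ?_, hle, lt_of_le_of_lt hle hn2⟩
  rw [Matrix.mul_add, Matrix.add_mul, Lk_Lam, zero_add]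
  ext1 j c
  have := congrFun (hx2 c) j
  rw [Matrix.add_apply, Matrix.zero_apply]
  have h2 : ((Lk 𝕂 ε ⊗ₖ (1 : Matrix (Fin n) (Fin n) (Polynomial 𝕂)) + ΔL21) *
    Matrix.of fun i c => x c i) j c = -B j c := this
  rw [h2]
  simp [hB]
end
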